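/- arXiv:1902.08435 — 4 statements merged into one kernel-verified Lean document; each statement's English description precedes it below -/
import Mathlib

section
/- As X → ∞, one has the asymptotic #𝓕(X) ~ (2^{4/3} / (3^{3/2} ζ(10))) · X^{5/6}, where ζ denotes the Riemann zeta function. -/
/-- Membership in the family 𝓕 : the discriminant condition and minimality condition. -/
def inFamily (A B : ℤ) : Prop :=
  4 * A ^ 3 + 27 * B ^ 2 ≠ 0 ∧
    ∀ p : ℕ, p.Prime → ¬((p : ℤ) ^ 4 ∣ A ∧ (p : ℤ) ^ 6 ∣ B)

/-- The height `H(E_{A,B}) = max {4|A|³, 27B²}`. -/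
def Eheight (A B : ℤ) : ℤ := max (4 * |A| ^ 3) (27 * B ^ 2)

/-- The family 𝓕(X), identified with the set of parameters `(A, B)`. -/
def FX (X : ℝ) : Set (ℤ × ℤ) :=
  {p | inFamily p.1 p.2 ∧ (Eheight p.1 p.2 : ℝ) ≤ X}

open Filter Topology Finset

/-- The pairs `(A, B)` with `d ^ 4 ∣ A` and `d ^ 6 ∣ B` for no prime `d`. -/
def IsMinimalPair (x : ℤ × ℤ) : Prop :=
  ∀ p : ℕ, p.Prime → ¬((p : ℤ) ^ 4 ∣ x.1 ∧ (p : ℤ) ^ 6 ∣ x.2)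

lemma IsMinimalPair.ne_zero {x : ℤ × ℤ} (hx : IsMinimalPair x) : x ≠ 0 := by
  rintro rfl
  exact hx 2 Nat.prime_two (by simp)

/-- The integer points of `[-m, m] × [-n, n]`. -/
noncomputable def intBox (m n : ℕ) : Finset (ℤ × ℤ) :=
  Icc (-(m : ℤ)) m ×ˢ Icc (-(n : ℤ)) n

lemma mem_intBox {m n : ℕ} {x : ℤ × ℤ} :
    x ∈ intBox m n ↔ x.1.natAbs ≤ m ∧ x.2.natAbs ≤ n := by
  simp only [intBox, mem_product, mem_Icc]
  omega

lemma Nat.le_add_of_pow_dvd {a b k l d : ℕ} (h : a ≠ 0 ∨ b ≠ 0) (hk : k ≠ 0) (hl : l ≠ 0)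
    (hd : d ^ k ∣ a ∧ d ^ l ∣ b) : d ≤ a + b := by
  rcases h with h | h
  · have := (Nat.le_self_pow hk d).trans (Nat.le_of_dvd (Nat.pos_of_ne_zero h) hd.1)
    omega
  · have := (Nat.le_self_pow hl d).trans (Nat.le_of_dvd (Nat.pos_of_ne_zero h) hd.2)
    omega

lemma Nat.exists_pow_dvd_and_pow_dvd_iff_dvd {a b k l : ℕ} (h : a ≠ 0 ∨ b ≠ 0) (hk : k ≠ 0)
    (hl : l ≠ 0) : ∃ D, D ≠ 0 ∧ ∀ d, (d ^ k ∣ a ∧ d ^ l ∣ b) ↔ d ∣ D := by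
  obtain ⟨D, hD, hmax⟩ := ((range (a + b + 1)).filter
    fun d => d ^ k ∣ a ∧ d ^ l ∣ b).exists_max_image id ⟨1, by simp; omega⟩
  simp only [mem_filter, mem_range, id] at hD hmax
  have hD0 : D ≠ 0 := by
    rintro rfl
    have := hmax 1 (by simp; omega)
    omega
  refine ⟨D, hD0, fun d => ⟨fun hd => ?_, fun hd => ?_⟩⟩
  · have hL : (d.lcm D) ^ k ∣ a ∧ (d.lcm D) ^ l ∣ b := by
      rw [← Nat.pow_lcm_pow, ← Nat.pow_lcm_pow]
      exact ⟨Nat.lcm_dvd hd.1 hD.2.1, Nat.lcm_dvd hd.2 hD.2.2⟩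
    have hle := hmax _ ⟨Nat.lt_succ_of_le (Nat.le_add_of_pow_dvd h hk hl hL), hL⟩
    have heq : d.lcm D = D :=
      le_antisymm hle (Nat.le_of_dvd (Nat.lcm_pos
        (Nat.pos_of_ne_zero fun h0 => by
          subst h0
          simp [hk, hl] at hd
          omega) (Nat.pos_of_ne_zero hD0)) (Nat.dvd_lcm_right d D))
    exact heq ▸ Nat.dvd_lcm_left d D
  · exact ⟨(pow_dvd_pow_of_dvd hd k).trans hD.2.1, (pow_dvd_pow_of_dvd hd l).trans hD.2.2⟩

lemma sum_moebius_divisors {D : ℕ} :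
    ∑ d ∈ D.divisors, ArithmeticFunction.moebius d = if D = 1 then 1 else 0 := by
  rw [← ArithmeticFunction.coe_mul_zeta_apply, ArithmeticFunction.moebius_mul_coe_zeta,
    ArithmeticFunction.one_apply]

open Classical in
lemma sum_moebius_filter_pow_dvd {x : ℤ × ℤ} (hx : x ≠ 0) {K : ℕ}
    (hK : x.1.natAbs + x.2.natAbs ≤ K) :
    ∑ d ∈ (Icc 1 K).filter (fun d : ℕ => (d : ℤ) ^ 4 ∣ x.1 ∧ (d : ℤ) ^ 6 ∣ x.2),
      ArithmeticFunction.moebius d = if IsMinimalPair x then 1 else 0 := by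
  have h0 : x.1.natAbs ≠ 0 ∨ x.2.natAbs ≠ 0 := by
    by_contra! h
    exact hx (Prod.ext (Int.natAbs_eq_zero.1 h.1) (Int.natAbs_eq_zero.1 h.2))
  have hcast (d : ℕ) : ((d : ℤ) ^ 4 ∣ x.1 ∧ (d : ℤ) ^ 6 ∣ x.2) ↔
      (d ^ 4 ∣ x.1.natAbs ∧ d ^ 6 ∣ x.2.natAbs) := by
    rw [← Int.natCast_dvd, ← Int.natCast_dvd]
    push_cast
    rfl
  obtain ⟨D, hD0, hD⟩ := Nat.exists_pow_dvd_and_pow_dvd_iff_dvd h0 four_ne_zero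
    (l := 6) (by norm_num)
  have hset : (Icc 1 K).filter (fun d : ℕ => (d : ℤ) ^ 4 ∣ x.1 ∧ (d : ℤ) ^ 6 ∣ x.2) =
      D.divisors := by
    ext d
    simp only [mem_filter, mem_Icc, Nat.mem_divisors, hcast, hD]
    refine ⟨fun h => ⟨h.2, hD0⟩, fun h => ⟨⟨Nat.pos_of_dvd_of_pos h.1 (Nat.pos_of_ne_zero hD0),
      (Nat.le_add_of_pow_dvd h0 four_ne_zero (l := 6) (by norm_num) ((hD d).2 h.1)).trans hK⟩, h.1⟩⟩
  rw [hset, sum_moebius_divisors]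
  congr 1
  simp only [IsMinimalPair, hcast, hD, eq_iff_iff]
  exact Nat.eq_one_iff_not_exists_prime_dvd

lemma card_filter_dvd_Icc_neg (m : ℕ) {r : ℕ} (hr : 0 < r) :
    #{x ∈ Icc (-(m : ℤ)) m | (r : ℤ) ∣ x} = 2 * (m / r) + 1 := by
  have : {x ∈ Icc (-(m : ℤ)) m | (r : ℤ) ∣ x} =
      (Icc (-((m / r : ℕ) : ℤ)) (m / r : ℕ)).image (fun y => (r : ℤ) * y) := by
    ext x
    simp only [mem_filter, mem_Icc, mem_image]
    have hr' : (0 : ℤ) < r := by exact_mod_cast hr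
    constructor
    · rintro ⟨⟨h1, h2⟩, y, rfl⟩
      refine ⟨y, ⟨?_, ?_⟩, rfl⟩ <;> push_cast
      · have : -y ≤ (m : ℤ) / r := (Int.le_ediv_iff_mul_le hr').2 (by linarith)
        linarith
      · exact (Int.le_ediv_iff_mul_le hr').2 (by linarith)
    · rintro ⟨y, ⟨h1, h2⟩, rfl⟩
      push_cast at h1 h2
      have h3 : -y ≤ (m : ℤ) / r := by linarith
      have := (Int.le_ediv_iff_mul_le hr').1 h2
      have := (Int.le_ediv_iff_mul_le hr').1 h3
      exact ⟨⟨by linarith, by linarith⟩, dvd_mul_right _ _⟩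
  rw [this, card_image_of_injective _ (mul_right_injective₀ (by exact_mod_cast hr.ne')),
    Int.card_Icc]
  omega

lemma card_filter_pow_dvd_intBox (m n : ℕ) {d : ℕ} (hd : 0 < d) :
    (#{x ∈ (intBox m n).erase 0 | (d : ℤ) ^ 4 ∣ x.1 ∧ (d : ℤ) ^ 6 ∣ x.2} : ℤ) =
      (2 * (m / d ^ 4 : ℕ) + 1) * (2 * (n / d ^ 6 : ℕ) + 1) - 1 := by
  have h := card_filter_dvd_Icc_neg m (pow_pos hd 4)
  have h' := card_filter_dvd_Icc_neg n (pow_pos hd 6)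
  push_cast at h h'
  rw [filter_erase, intBox, filter_product (fun a : ℤ => (d : ℤ) ^ 4 ∣ a)
    (fun b : ℤ => (d : ℤ) ^ 6 ∣ b), card_erase_of_mem (by simp), card_product, h, h',
    Nat.cast_sub (by nlinarith [Nat.zero_le (m / d ^ 4), Nat.zero_le (n / d ^ 6)])]
  push_cast
  rfl

open Classical in
lemma card_filter_isMinimalPair (m n : ℕ) :
    (#{x ∈ intBox m n | IsMinimalPair x} : ℤ) =
      ∑ d ∈ Icc 1 (m + n), ArithmeticFunction.moebius d *
        ((2 * (m / d ^ 4 : ℕ) + 1) * (2 * (n / d ^ 6 : ℕ) + 1) - 1) := by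
  have h1 : {x ∈ intBox m n | IsMinimalPair x} =
      {x ∈ (intBox m n).erase 0 | IsMinimalPair x} := by
    ext x
    simp only [mem_filter, mem_erase]
    exact ⟨fun h => ⟨⟨h.2.ne_zero, h.1⟩, h.2⟩, fun h => ⟨h.1.2, h.2⟩⟩
  rw [h1, natCast_card_filter]
  calc _ = ∑ x ∈ (intBox m n).erase 0, ∑ d ∈ Icc 1 (m + n),
        if (d : ℤ) ^ 4 ∣ x.1 ∧ (d : ℤ) ^ 6 ∣ x.2 then ArithmeticFunction.moebius d else 0 := by
        refine sum_congr rfl fun x hx => ?_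
        rw [mem_erase, mem_intBox] at hx
        rw [← sum_filter, sum_moebius_filter_pow_dvd hx.1 (by omega)]
    _ = _ := by
        rw [sum_comm]
        refine sum_congr rfl fun d hd => ?_
        rw [← card_filter_pow_dvd_intBox m n (mem_Icc.1 hd).1, ← sum_filter, sum_const,
          nsmul_eq_mul, mul_comm]

/-- The number of nonzero integer points of `[-α t⁴, α t⁴] × [-β t⁶, β t⁶]`. -/
noncomputable def boxCount (α β t : ℝ) : ℝ :=
  (2 * (⌊α * t ^ 4⌋₊ : ℝ) + 1) * (2 * (⌊β * t ^ 6⌋₊ : ℝ) + 1) - 1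

lemma boxCount_nonneg (α β t : ℝ) : 0 ≤ boxCount α β t := by
  have : 0 ≤ 4 * (⌊α * t ^ 4⌋₊ : ℝ) * (⌊β * t ^ 6⌋₊ : ℝ) + 2 * (⌊α * t ^ 4⌋₊ : ℝ)
    + 2 * (⌊β * t ^ 6⌋₊ : ℝ) := by positivity
  unfold boxCount
  linarith

lemma boxCount_eq_zero {α β t : ℝ} (hα : α * t ^ 4 < 1) (hβ : β * t ^ 6 < 1) :
    boxCount α β t = 0 := by
  simp [boxCount, Nat.floor_eq_zero.2 hα, Nat.floor_eq_zero.2 hβ]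

lemma boxCount_le {α β t : ℝ} (hα : 0 ≤ α) (hα1 : α ≤ 1) (hβ : 0 ≤ β) (hβ1 : β ≤ 1)
    (ht : 0 ≤ t) : boxCount α β t ≤ 8 * t ^ 10 := by
  rcases lt_or_ge t 1 with h | h
  · rw [boxCount_eq_zero]
    · positivity
    · exact (mul_le_of_le_one_left (by positivity) hα1).trans_lt (pow_lt_one₀ ht h four_ne_zero)
    · exact (mul_le_of_le_one_left (by positivity) hβ1).trans_lt (pow_lt_one₀ ht h (by norm_num))
  · have ha : (⌊α * t ^ 4⌋₊ : ℝ) ≤ t ^ 4 := (Nat.floor_le (by positivity)).trans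
      (mul_le_of_le_one_left (by positivity) hα1)
    have hb : (⌊β * t ^ 6⌋₊ : ℝ) ≤ t ^ 6 := (Nat.floor_le (by positivity)).trans
      (mul_le_of_le_one_left (by positivity) hβ1)
    have h4 : t ^ 4 ≤ t ^ 10 := pow_le_pow_right₀ h (by norm_num)
    have h6 : t ^ 6 ≤ t ^ 10 := pow_le_pow_right₀ h (by norm_num)
    have hab : (⌊α * t ^ 4⌋₊ : ℝ) * (⌊β * t ^ 6⌋₊ : ℝ) ≤ t ^ 10 :=
      (mul_le_mul ha hb (by positivity) (by positivity)).trans_eq (by ring)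
    unfold boxCount
    linarith

lemma tendsto_boxCount_div {α β : ℝ} (hα : 0 ≤ α) (hβ : 0 ≤ β) :
    Tendsto (fun t => boxCount α β t / t ^ 10) atTop (𝓝 (4 * α * β)) := by
  have ha := (tendsto_nat_floor_mul_div_atTop hα).comp
    (tendsto_pow_atTop (α := ℝ) four_ne_zero)
  have hb := (tendsto_nat_floor_mul_div_atTop hβ).comp
    (tendsto_pow_atTop (α := ℝ) (n := 6) (by norm_num))
  have h4 := (tendsto_pow_atTop (α := ℝ) four_ne_zero).inv_tendsto_atTop
  have h6 := (tendsto_pow_atTop (α := ℝ) (n := 6) (by norm_num)).inv_tendsto_atTop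
  have := (((ha.const_mul 4).mul hb).add ((ha.const_mul 2).mul h6)).add ((hb.const_mul 2).mul h4)
  simp only [mul_zero, add_zero] at this
  refine this.congr' ?_
  filter_upwards [eventually_gt_atTop 0] with t ht
  simp only [Function.comp_apply, Pi.inv_apply, boxCount]
  field_simp
  ring

lemma norm_moebius_le_one (d : ℕ) : ‖(ArithmeticFunction.moebius d : ℝ)‖ ≤ 1 := by
  rw [Real.norm_eq_abs]
  exact_mod_cast ArithmeticFunction.abs_moebius_le_one

lemma tendsto_tsum_moebius_mul_boxCount {α β : ℝ} (hα : 0 ≤ α) (hα1 : α ≤ 1) (hβ : 0 ≤ β)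
    (hβ1 : β ≤ 1) :
    Tendsto (fun T : ℝ => ∑' d : ℕ, (ArithmeticFunction.moebius d : ℝ) *
      (boxCount α β (T / d) / T ^ 10)) atTop
      (𝓝 (∑' d : ℕ, (ArithmeticFunction.moebius d : ℝ) * (4 * α * β / d ^ 10))) := by
  refine tendsto_tsum_of_dominated_convergence (bound := fun d : ℕ => 8 * (1 / (d : ℝ) ^ 10))
    ((Real.summable_one_div_nat_pow.2 (by norm_num)).mul_left 8) (fun d => ?_) ?_
  · refine Tendsto.const_mul _ ?_
    rcases Nat.eq_zero_or_pos d with rfl | hd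
    · simp [boxCount]
    have hd' : (0 : ℝ) < d := by exact_mod_cast hd
    have := ((tendsto_boxCount_div hα hβ).comp (tendsto_id.atTop_div_const hd')).div_const
      ((d : ℝ) ^ 10)
    refine this.congr fun T => ?_
    simp only [Function.comp_apply, id, div_pow]
    field_simp
  · filter_upwards [eventually_gt_atTop 0] with T hT d
    have hT10 : 0 < T ^ 10 := by positivity
    rw [norm_mul]
    refine (mul_le_of_le_one_left (norm_nonneg _) (norm_moebius_le_one d)).trans ?_
    rw [Real.norm_of_nonneg (div_nonneg (boxCount_nonneg _ _ _) hT10.le), div_le_iff₀ hT10]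
    refine (boxCount_le hα hα1 hβ hβ1 (by positivity)).trans_eq ?_
    rw [div_pow]
    ring

open Classical in
lemma card_filter_isMinimalPair_eq_tsum (α β T : ℝ) :
    (#{x ∈ intBox ⌊α * T ^ 4⌋₊ ⌊β * T ^ 6⌋₊ | IsMinimalPair x} : ℝ) =
      ∑' d : ℕ, (ArithmeticFunction.moebius d : ℝ) * boxCount α β (T / d) := by
  set m := ⌊α * T ^ 4⌋₊ with hm
  set n := ⌊β * T ^ 6⌋₊ with hn
  have hbox (d : ℕ) : boxCount α β (T / d) =
      (2 * ((m / d ^ 4 : ℕ) : ℝ) + 1) * (2 * ((n / d ^ 6 : ℕ) : ℝ) + 1) - 1 := by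
    rw [boxCount, hm, hn, ← Nat.floor_div_natCast, ← Nat.floor_div_natCast, div_pow, div_pow,
      mul_div_assoc, mul_div_assoc]
    push_cast
    rfl
  rw [tsum_eq_sum (s := Icc 1 (m + n))]
  · simp_rw [hbox]
    exact_mod_cast congrArg (Int.cast (R := ℝ)) (card_filter_isMinimalPair m n)
  · intro d hd
    rcases Nat.eq_zero_or_pos d with rfl | hd0
    · simp
    have hlt : m + n < d := by
      by_contra! h
      exact hd (mem_Icc.2 ⟨hd0, h⟩)
    rw [hbox, Nat.div_eq_of_lt, Nat.div_eq_of_lt]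
    · simp
    · exact (by omega : n < d).trans_le (Nat.le_self_pow (by norm_num) d)
    · exact (by omega : m < d).trans_le (Nat.le_self_pow (by norm_num) d)

lemma tsum_moebius_div_pow_eq_inv_zeta {k : ℕ} (hk : 1 < k) :
    ∑' d : ℕ, (ArithmeticFunction.moebius d : ℝ) / d ^ k = ((riemannZeta k).re)⁻¹ := by
  have hs : 1 < (k : ℂ).re := by simpa using hk
  have h := ArithmeticFunction.LSeries_zeta_mul_Lseries_moebius hs
  rw [ArithmeticFunction.LSeries_zeta_eq_riemannZeta hs] at h
  have hz : riemannZeta k = ((∑' n : ℕ, 1 / (n : ℝ) ^ k : ℝ) : ℂ) := by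
    rw [zeta_nat_eq_tsum_of_gt_one hk]
    push_cast
    rfl
  have hL : LSeries (fun n => (ArithmeticFunction.moebius n : ℂ)) k =
      ((∑' d : ℕ, (ArithmeticFunction.moebius d : ℝ) / d ^ k : ℝ) : ℂ) := by
    rw [LSeries, Complex.ofReal_tsum]
    refine tsum_congr fun d => ?_
    rcases Nat.eq_zero_or_pos d with rfl | hd
    · simp
    · rw [LSeries.term_of_ne_zero hd.ne', Complex.cpow_natCast]
      push_cast
      rfl
  rw [hL, hz, ← Complex.ofReal_mul] at h
  rw [hz, Complex.ofReal_re]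
  exact eq_inv_of_mul_eq_one_right (by exact_mod_cast h)

open Classical in
lemma tendsto_card_filter_isMinimalPair_div {α β : ℝ} (hα : 0 ≤ α) (hα1 : α ≤ 1) (hβ : 0 ≤ β)
    (hβ1 : β ≤ 1) :
    Tendsto (fun T : ℝ =>
      (#{x ∈ intBox ⌊α * T ^ 4⌋₊ ⌊β * T ^ 6⌋₊ | IsMinimalPair x} : ℝ) / T ^ 10) atTop
      (𝓝 (4 * α * β / (riemannZeta 10).re)) := by
  have h := tendsto_tsum_moebius_mul_boxCount hα hα1 hβ hβ1
  have hz := tsum_moebius_div_pow_eq_inv_zeta (k := 10) (by norm_num)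
  have hlim : ∑' d : ℕ, (ArithmeticFunction.moebius d : ℝ) * (4 * α * β / d ^ 10) =
      4 * α * β / (riemannZeta 10).re := by
    rw [div_eq_mul_inv _ (riemannZeta 10).re]
    push_cast at hz
    rw [← hz, ← tsum_mul_left]
    exact tsum_congr fun d => by ring
  rw [hlim] at h
  refine h.congr fun T => ?_
  rw [card_filter_isMinimalPair_eq_tsum, ← tsum_div_const]
  exact tsum_congr fun d => by ring

lemma card_filter_singular_le (m n : ℕ) :
    #{x ∈ intBox m n | 4 * x.1 ^ 3 + 27 * x.2 ^ 2 = 0} ≤ 2 * n + 1 := by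
  have hcard : #(Icc (-(n : ℤ)) n) = 2 * n + 1 := by
    rw [Int.card_Icc]
    omega
  rw [← hcard]
  refine card_le_card_of_injOn Prod.snd (fun x hx => ?_) fun x hx y hy hxy => ?_
  · simp only [intBox, mem_product, coe_filter, Set.mem_ofPred_eq] at hx
    exact hx.1.2
  · simp only [coe_filter, Set.mem_ofPred_eq] at hx hy
    refine Prod.ext ?_ hxy
    have h3 : x.1 ^ 3 = y.1 ^ 3 := by
      have h1 := hx.2
      rw [hxy] at h1
      linarith [hy.2]
    exact (Odd.strictMono_pow (by decide : Odd 3)).injective h3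

lemma mem_FX_pow_iff {α β T : ℝ} (hα : 0 ≤ α) (hα3 : 4 * α ^ 3 = 1) (hβ : 0 ≤ β)
    (hβ2 : 27 * β ^ 2 = 1) (x : ℤ × ℤ) :
    x ∈ FX (T ^ 12) ↔ x ∈ intBox ⌊α * T ^ 4⌋₊ ⌊β * T ^ 6⌋₊ ∧ IsMinimalPair x ∧
      4 * x.1 ^ 3 + 27 * x.2 ^ 2 ≠ 0 := by
  have h1 : 4 * |(x.1 : ℝ)| ^ 3 ≤ T ^ 12 ↔ |(x.1 : ℝ)| ≤ α * T ^ 4 := by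
    rw [← pow_le_pow_iff_left₀ (abs_nonneg (x.1 : ℝ)) (by positivity) three_ne_zero]
    have : T ^ 12 = 4 * (α * T ^ 4) ^ 3 := by linear_combination (-T ^ 12) * hα3
    constructor <;> intro <;> linarith
  have h2 : 27 * (x.2 : ℝ) ^ 2 ≤ T ^ 12 ↔ |(x.2 : ℝ)| ≤ β * T ^ 6 := by
    rw [← pow_le_pow_iff_left₀ (abs_nonneg (x.2 : ℝ)) (by positivity) two_ne_zero, sq_abs]
    have : T ^ 12 = 27 * (β * T ^ 6) ^ 2 := by linear_combination (-T ^ 12) * hβ2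
    constructor <;> intro <;> linarith
  have hheight : (Eheight x.1 x.2 : ℝ) ≤ T ^ 12 ↔ x ∈ intBox ⌊α * T ^ 4⌋₊ ⌊β * T ^ 6⌋₊ := by
    rw [mem_intBox, Nat.le_floor_iff (by positivity), Nat.le_floor_iff (by positivity),
      Nat.cast_natAbs, Nat.cast_natAbs, Int.cast_abs, Int.cast_abs, ← h1, ← h2, ← max_le_iff]
    simp [Eheight]
  rw [FX, Set.mem_ofPred_eq, hheight, inFamily]
  unfold IsMinimalPair
  tauto

lemma tendsto_card_FX_pow_div {α β : ℝ} (hα : 0 ≤ α) (hα3 : 4 * α ^ 3 = 1) (hβ : 0 ≤ β)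
    (hβ2 : 27 * β ^ 2 = 1) :
    Tendsto (fun T : ℝ => (Nat.card {p : ℤ × ℤ // p ∈ FX (T ^ 12)} : ℝ) / T ^ 10) atTop
      (𝓝 (4 * α * β / (riemannZeta 10).re)) := by
  classical
  have hα1 : α ≤ 1 := by
    by_contra! h
    nlinarith [one_lt_pow₀ h three_ne_zero]
  have hβ1 : β ≤ 1 := by nlinarith
  have hlim := tendsto_card_filter_isMinimalPair_div hα hα1 hβ hβ1
  have herr : Tendsto (fun T : ℝ => 2 * β * (T ^ 4)⁻¹ + (T ^ 10)⁻¹) atTop (𝓝 0) := by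
    have h4 := (tendsto_pow_atTop (α := ℝ) four_ne_zero).inv_tendsto_atTop
    have h10 := (tendsto_pow_atTop (α := ℝ) (n := 10) (by norm_num)).inv_tendsto_atTop
    simpa using (h4.const_mul (2 * β)).add h10
  have hlow := hlim.sub herr
  rw [sub_zero] at hlow
  have hcard (T : ℝ) : Nat.card {p : ℤ × ℤ // p ∈ FX (T ^ 12)} =
      #{x ∈ intBox ⌊α * T ^ 4⌋₊ ⌊β * T ^ 6⌋₊ |
        IsMinimalPair x ∧ 4 * x.1 ^ 3 + 27 * x.2 ^ 2 ≠ 0} := by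
    refine Nat.subtype_card _ fun x => ?_
    rw [mem_filter, mem_FX_pow_iff hα hα3 hβ hβ2]
  refine tendsto_of_tendsto_of_tendsto_of_le_of_le' hlow hlim ?_ ?_
  · filter_upwards [eventually_gt_atTop 0] with T hT
    rw [hcard]
    set m := ⌊α * T ^ 4⌋₊
    set n := ⌊β * T ^ 6⌋₊ with hn
    have h1 : #{x ∈ intBox m n | IsMinimalPair x} ≤
        #{x ∈ intBox m n | IsMinimalPair x ∧ 4 * x.1 ^ 3 + 27 * x.2 ^ 2 ≠ 0} +
          #{x ∈ intBox m n | 4 * x.1 ^ 3 + 27 * x.2 ^ 2 = 0} := by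
      refine (card_le_card fun x hx => ?_).trans (card_union_le _ _)
      simp only [mem_union, mem_filter] at hx ⊢
      tauto
    have h2 := h1.trans (Nat.add_le_add_left (card_filter_singular_le m n) _)
    have h3 : (n : ℝ) ≤ β * T ^ 6 := Nat.floor_le (by positivity)
    have h4 : (#{x ∈ intBox m n | IsMinimalPair x} : ℝ) ≤
        #{x ∈ intBox m n | IsMinimalPair x ∧ 4 * x.1 ^ 3 + 27 * x.2 ^ 2 ≠ 0} +
          (2 * n + 1) := by exact_mod_cast h2
    have h5 : 2 * β * (T ^ 4)⁻¹ + (T ^ 10)⁻¹ = (2 * (β * T ^ 6) + 1) / T ^ 10 := by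
      field_simp
    rw [h5, ← sub_div]
    gcongr
    linarith
  · filter_upwards [eventually_gt_atTop 0] with T hT
    rw [hcard]
    gcongr
    exact fun h => h.1

/-- `#𝓕(X) ∼ (2^{4/3} / (3^{3/2} ζ(10))) X^{5/6}` as `X → ∞`. -/
theorem FX_asymptotic :
    Filter.Tendsto
      (fun X : ℝ => (Nat.card {p : ℤ × ℤ // p ∈ FX X} : ℝ) / X ^ ((5 : ℝ) / 6))
      Filter.atTop
      (nhds ((2 : ℝ) ^ ((4 : ℝ) / 3) / ((3 : ℝ) ^ ((3 : ℝ) / 2) * (riemannZeta 10).re))) := by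
  have hα3 : 4 * ((2 : ℝ) ^ (-(2 : ℝ) / 3)) ^ 3 = 1 := by
    rw [← Real.rpow_mul_natCast (by norm_num)]
    norm_num [Real.rpow_neg]
  have hβ2 : 27 * ((3 : ℝ) ^ (-(3 : ℝ) / 2)) ^ 2 = 1 := by
    rw [← Real.rpow_mul_natCast (by norm_num)]
    norm_num [Real.rpow_neg]
  have hconst : 4 * (2 : ℝ) ^ (-(2 : ℝ) / 3) * (3 : ℝ) ^ (-(3 : ℝ) / 2) / (riemannZeta 10).re =
      (2 : ℝ) ^ ((4 : ℝ) / 3) / ((3 : ℝ) ^ ((3 : ℝ) / 2) * (riemannZeta 10).re) := by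
    have h2 : 4 * (2 : ℝ) ^ (-(2 : ℝ) / 3) = (2 : ℝ) ^ ((4 : ℝ) / 3) := by
      rw [show (4 : ℝ) / 3 = 2 + -(2 : ℝ) / 3 by norm_num, Real.rpow_add two_pos]
      norm_num
    rw [h2, neg_div, Real.rpow_neg (by norm_num), ← div_eq_mul_inv, div_div]
  have h := (tendsto_card_FX_pow_div (by positivity) hα3 (by positivity) hβ2).comp
    (tendsto_rpow_atTop (y := 1 / 12) (by norm_num))
  rw [hconst] at h
  refine h.congr' ?_
  filter_upwards [Filter.eventually_ge_atTop 0] with X hX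
  have h12 : (X ^ ((1 : ℝ) / 12)) ^ 12 = X := by
    rw [← Real.rpow_mul_natCast hX]
    norm_num
  have h10 : (X ^ ((1 : ℝ) / 12)) ^ 10 = X ^ ((5 : ℝ) / 6) := by
    rw [← Real.rpow_mul_natCast hX]
    norm_num
  simp only [Function.comp_apply, h12, h10]
end

section
/- Let δ ∈ (0, 1/6) be fixed. Then #𝓕_δ(X) = #𝓕(X) · (1 + O(X^{−5δ/6})), i.e. there is a constant C (depending only on δ) with |#𝓕(X) − #𝓕_δ(X)| ≤ C·#𝓕(X)·X^{−5δ/6} for all X ≥ 1. -/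
/-- The discriminant `Δ(E_{A,B}) = -16(4A³ + 27B²)`. -/
def discAB (A B : ℤ) : ℤ := -16 * (4 * A ^ 3 + 27 * B ^ 2)

/-- For `n ≠ 0`, `sqPart n` is the unique `ℓ ≥ 1` such that `n = m ℓ²` with `m` squarefree,
namely `∏ p, p ^ (v_p(n) / 2)`. -/
def sqPart (n : ℤ) : ℕ := n.natAbs.factorization.prod fun p e => p ^ (e / 2)

/-- The subfamily 𝓕_δ(X). -/
def Fdelta (δ X : ℝ) : Set (ℤ × ℤ) :=
  {p ∈ FX X | X ^ (1 - δ) < |(discAB p.1 p.2 : ℝ)| ∧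
    (sqPart (discAB p.1 p.2) : ℝ) ≤ 4 * X ^ δ}

/-- The divisor bound: `τ(n) ≪ n ^ ε`. -/
theorem exists_card_divisors_le_rpow {ε : ℝ} (hε : 0 < ε) :
    ∃ C : ℝ, 1 ≤ C ∧ ∀ n : ℕ, n ≠ 0 → (n.divisors.card : ℝ) ≤ C * (n : ℝ) ^ ε := by
  have hl : 0 < Real.log 2 := Real.log_pos (by norm_num)
  set M : ℝ := 1 + 1 / (ε * Real.log 2) with hM
  have hM1 : 1 ≤ M := by rw [hM]; have : 0 < 1 / (ε * Real.log 2) := by positivity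
                         linarith
  set P : ℕ := ⌈(2 : ℝ) ^ (1 / ε)⌉₊ with hP
  have key : ∀ p e : ℕ, 2 ≤ p →
      ((e + 1 : ℕ) : ℝ) ≤ (if p < P then M else 1) * ((p : ℝ) ^ ε) ^ e := by
    intro p e hp
    have hp' : (2 : ℝ) ≤ p := by exact_mod_cast hp
    split_ifs with h
    · have h1 : (2 : ℝ) ^ ε ≤ (p : ℝ) ^ ε := Real.rpow_le_rpow (by norm_num) hp' hε.le
      have h2 : 1 + ε * Real.log 2 ≤ (2 : ℝ) ^ ε := by
        rw [Real.rpow_def_of_pos (by norm_num)]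
        have := Real.add_one_le_exp (Real.log 2 * ε)
        linarith
      have h3 : 1 + (e : ℝ) * (ε * Real.log 2) ≤ (1 + ε * Real.log 2) ^ e :=
        one_add_mul_le_pow (by have : 0 < ε * Real.log 2 := by positivity
                               linarith) e
      have h4 : (1 + ε * Real.log 2) ^ e ≤ ((p : ℝ) ^ ε) ^ e :=
        pow_le_pow_left₀ (by positivity) (h2.trans h1) e
      calc ((e + 1 : ℕ) : ℝ) ≤ M * (1 + (e : ℝ) * (ε * Real.log 2)) := by
            have h5 : M * (1 + (e : ℝ) * (ε * Real.log 2))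
                = 1 + e + e * (ε * Real.log 2) + 1 / (ε * Real.log 2) := by
              rw [hM]; field_simp; ring
            rw [h5]; push_cast
            have : 0 ≤ e * (ε * Real.log 2) + 1 / (ε * Real.log 2) := by positivity
            linarith
        _ ≤ M * ((p : ℝ) ^ ε) ^ e := by gcongr; exact h3.trans h4
    · have h1 : (2 : ℝ) ^ (1 / ε) ≤ p := (Nat.le_ceil _).trans (by exact_mod_cast not_lt.mp h)
      have h2 : (2 : ℝ) ≤ (p : ℝ) ^ ε := by
        calc (2 : ℝ) = ((2 : ℝ) ^ (1 / ε)) ^ ε := by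
              rw [← Real.rpow_mul (by norm_num)]; field_simp; simp
          _ ≤ _ := Real.rpow_le_rpow (by positivity) h1 hε.le
      have h3 : (e + 1 : ℕ) ≤ 2 ^ e := Nat.lt_two_pow_self
      calc ((e + 1 : ℕ) : ℝ) ≤ 2 ^ e := by exact_mod_cast h3
        _ ≤ ((p : ℝ) ^ ε) ^ e := pow_le_pow_left₀ (by norm_num) h2 e
        _ = _ := by ring
  refine ⟨M ^ P, one_le_pow₀ hM1, fun n hn => ?_⟩
  rw [Nat.card_divisors hn]
  push_cast
  calc ∏ p ∈ n.primeFactors, ((n.factorization p : ℝ) + 1)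
      ≤ ∏ p ∈ n.primeFactors, ((if p < P then M else 1) * ((p : ℝ) ^ ε) ^ n.factorization p) := by
        refine Finset.prod_le_prod (fun _ _ => by positivity) fun p hp => ?_
        have := key p (n.factorization p) (Nat.prime_of_mem_primeFactors hp).two_le
        push_cast at this
        exact this
    _ = (∏ p ∈ n.primeFactors, if p < P then M else 1) *
        (∏ p ∈ n.primeFactors, ((p : ℝ) ^ ε) ^ n.factorization p) := Finset.prod_mul_distrib
    _ ≤ M ^ P * (n : ℝ) ^ ε := by
        gcongr
        · rw [Finset.prod_ite, Finset.prod_const_one, mul_one, Finset.prod_const]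
          refine pow_le_pow_right₀ hM1 ?_
          calc _ ≤ (Finset.range P).card := Finset.card_le_card fun p hp => by
                simpa using (Finset.mem_filter.1 hp).2
            _ = P := Finset.card_range P
        · refine le_of_eq ?_
          conv_rhs => rw [← Nat.prod_factorization_pow_eq_self hn]
          rw [Finsupp.prod, Nat.support_factorization]
          push_cast
          rw [← Real.finsetProd_rpow _ _ (fun _ _ => by positivity)]
          refine Finset.prod_congr rfl fun p _ => ?_
          rw [← Real.rpow_natCast, ← Real.rpow_natCast, ← Real.rpow_mul (by positivity),
            ← Real.rpow_mul (by positivity), mul_comm]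

/-- `sqPart n` is the square root of the largest square dividing `n`. -/
theorem exists_squarefree_mul_sqPart_sq {n : ℤ} (hn : n ≠ 0) :
    ∃ m : ℤ, Squarefree m ∧ n = m * (sqPart n : ℤ) ^ 2 := by
  obtain ⟨a, b, hab, ha⟩ := Nat.sq_mul_squarefree n.natAbs
  have hb0 : b ≠ 0 := by rintro rfl; simp at hab; omega
  have ha0 : a ≠ 0 := ha.ne_zero
  have hfac : ∀ p, n.natAbs.factorization p / 2 = b.factorization p := by
    intro p
    rw [← hab, Nat.factorization_mul (by positivity) ha0, Nat.factorization_pow]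
    have := ha.natFactorization_le_one p
    simp
    omega
  have hsq : sqPart n = b := by
    rw [sqPart, Finsupp.prod]
    conv_rhs => rw [← Nat.prod_factorization_pow_eq_self hb0]
    rw [Finsupp.prod]
    simp_rw [hfac]
    symm
    refine Finset.prod_subset ?_ ?_
    · intro p hp
      rw [Finsupp.mem_support_iff] at hp ⊢
      have := hfac p
      omega
    · intro p _ hp
      rw [Finsupp.notMem_support_iff] at hp
      simp [hp]
  rw [hsq]
  refine ⟨n.sign * a, ?_, ?_⟩
  · rw [← Int.squarefree_natAbs, Int.natAbs_mul, Int.natAbs_sign_of_ne_zero hn]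
    simpa using ha
  · conv_lhs => rw [← Int.sign_mul_natAbs n, ← hab]
    push_cast
    ring

/-- The square roots of `c` modulo `n`, as residues in `[0, n)`. -/
noncomputable def sqrtsMod (c : ℤ) (n : ℕ) : Finset ℤ :=
  (Finset.Ico 0 (n : ℤ)).filter fun r => (n : ℤ) ∣ r ^ 2 - c

/-- The numbers whose square divides both `n` and `4 * c`. -/
def sqDivs (c : ℤ) (n : ℕ) : Finset ℕ :=
  (Finset.range (n + 1)).filter fun g => g ^ 2 ∣ n ∧ (g : ℤ) ^ 2 ∣ 4 * c

theorem card_sqrtsMod_le (c : ℤ) {n : ℕ} (hn : 0 < n) :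
    (sqrtsMod c n).card ≤ (∑ g ∈ sqDivs c n, g) * n.divisors.card := by
  rcases (sqrtsMod c n).eq_empty_or_nonempty with h0 | ⟨s, hs⟩
  · simp [h0]
  have hs' := (Finset.mem_filter.1 hs).2
  refine Finset.card_le_mul_card_image_of_maps_to (f := fun r => Int.gcd (r - s) n)
    (fun r _ => Nat.mem_divisors.2
      ⟨Int.natCast_dvd_natCast.1 (Int.gcd_dvd_right _ _), hn.ne'⟩) _ fun e he => ?_
  rcases ((sqrtsMod c n).filter fun r => Int.gcd (r - s) n = e).eq_empty_or_nonempty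
    with h0 | ⟨t, ht⟩
  · rw [h0]; simp
  obtain ⟨k, hk⟩ := (Nat.mem_divisors.1 he).1
  have he0 : 0 < e := Nat.pos_of_ne_zero fun h => by simp [h] at hk; omega
  have hk0 : 0 < k := Nat.pos_of_ne_zero fun h => by simp [h] at hk; omega
  have fib : ∀ r ∈ (sqrtsMod c n).filter fun r => Int.gcd (r - s) n = e,
      (e : ℤ) ∣ r - s ∧ (k : ℤ) ∣ r + s := by
    intro r hr
    obtain ⟨hr1, hr2⟩ := Finset.mem_filter.1 hr
    have hr3 := (Finset.mem_filter.1 hr1).2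
    have he1 : (e : ℤ) ∣ r - s := hr2 ▸ Int.gcd_dvd_left _ _
    refine ⟨he1, ?_⟩
    obtain ⟨x, hx⟩ := he1
    have h1 : (n : ℤ) ∣ (r - s) * (r + s) := by
      have := dvd_sub hr3 hs'
      exact this.trans (dvd_of_eq (by ring))
    have hcop : IsCoprime (k : ℤ) x := by
      rw [Int.isCoprime_iff_gcd_eq_one, Int.gcd_comm]
      have h2 : Int.gcd ((e : ℤ) * x) ((e : ℤ) * k) = e * 1 := by
        rw [← hx, mul_one]; rw [hk] at hr2; exact_mod_cast hr2
      rw [Int.gcd_mul_left, Int.natAbs_natCast] at h2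
      exact Nat.eq_of_mul_eq_mul_left he0 h2
    rw [hx, hk, Nat.cast_mul, mul_assoc] at h1
    exact hcop.dvd_of_dvd_mul_left
      (Int.dvd_of_mul_dvd_mul_left (by exact_mod_cast he0.ne') h1)
  set g := Nat.gcd e k with hg
  have hg0 : 0 < g := Nat.gcd_pos_of_pos_left _ he0
  set q := Nat.lcm e k with hq
  have hgq : g * q = n := by rw [hg, hq, Nat.gcd_mul_lcm, hk]
  have hq0 : 0 < q := Nat.lcm_pos he0 hk0
  have hge : (g : ℤ) ∣ e := by exact_mod_cast Nat.gcd_dvd_left e k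
  have hgk : (g : ℤ) ∣ k := by exact_mod_cast Nat.gcd_dvd_right e k
  have hgn : (g : ℤ) ^ 2 ∣ n := by
    rw [hk, Nat.cast_mul, sq]; exact mul_dvd_mul hge hgk
  have hgmem : g ∈ sqDivs c n := by
    refine Finset.mem_filter.2 ⟨?_, by exact_mod_cast hgn, ?_⟩
    · rw [Finset.mem_range, Nat.lt_succ_iff]
      exact Nat.le_of_dvd hn ((dvd_mul_right g q).trans hgq.dvd)
    · obtain ⟨h1, h2⟩ := fib t ht
      have h3 : (g : ℤ) ∣ 2 * s := by
        have := dvd_sub (hgk.trans h2) (hge.trans h1)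
        exact this.trans (dvd_of_eq (by ring))
      have h4 := pow_dvd_pow_of_dvd h3 2
      have h5 := (hgn.trans hs').mul_left 4
      have := dvd_sub h4 h5
      exact this.trans (dvd_of_eq (by ring))
  refine le_trans ?_ (Finset.single_le_sum (f := fun g => g) (fun _ _ => Nat.zero_le _) hgmem)
  have hcard : (Finset.Ico (0 : ℤ) g).card = g := by simp
  rw [← hcard]
  refine Finset.card_le_card_of_injOn (fun r => r / q) ?_ ?_
  · intro r hr
    have hr1 := (Finset.mem_filter.1 (Finset.mem_filter.1 hr).1).1
    rw [Finset.mem_Ico] at hr1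
    have hq' : (0 : ℤ) < q := by exact_mod_cast hq0
    simp only [Finset.coe_Ico, Set.mem_Ico]
    refine ⟨Int.ediv_nonneg hr1.1 hq'.le, Int.ediv_lt_of_lt_mul hq' ?_⟩
    rw [← hgq] at hr1; push_cast at hr1; exact hr1.2
  · intro r hr r' hr' heq
    simp only at heq
    obtain ⟨h1, h2⟩ := fib r hr
    obtain ⟨h1', h2'⟩ := fib r' hr'
    have h3 : (q : ℤ) ∣ r - r' := by
      have e1 : (e : ℤ) ∣ r - r' := by
        have := dvd_sub h1 h1'
        exact this.trans (dvd_of_eq (by ring))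
      have e2 : (k : ℤ) ∣ r - r' := by
        have := dvd_sub h2 h2'
        exact this.trans (dvd_of_eq (by ring))
      rw [Int.natCast_dvd] at *
      exact Nat.lcm_dvd e1 e2
    have h4 : r % q = r' % q := Int.emod_eq_emod_iff_emod_sub_eq_zero.2 (Int.emod_eq_zero_of_dvd h3)
    rw [← Int.mul_ediv_add_emod r q, ← Int.mul_ediv_add_emod r' q, heq, h4]

theorem card_filter_dvd_sq_sub_le (c : ℤ) (T : ℕ) {n : ℕ} (hn : 0 < n) :
    ((Finset.Icc (-T : ℤ) T).filter fun u => (n : ℤ) ∣ u ^ 2 - c).card ≤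
      (sqrtsMod c n).card * (2 * (T / n) + 2) := by
  have hn' : (0 : ℤ) < n := by exact_mod_cast hn
  have hcard : (Finset.Icc (-((T / n : ℕ) : ℤ) - 1) ((T / n : ℕ) : ℤ)).card = 2 * (T / n) + 2 := by
    rw [Int.card_Icc]; omega
  rw [← hcard, ← Finset.card_product]
  refine Finset.card_le_card_of_injOn (fun u => (u % n, u / n)) ?_ ?_
  · intro u hu
    obtain ⟨h1, h2⟩ := Finset.mem_filter.1 hu
    rw [Finset.mem_Icc] at h1
    have hT : (T : ℤ) / n * n ≤ T := Int.ediv_mul_le _ hn'.ne'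
    have hT' : (T : ℤ) < ((T : ℤ) / n + 1) * n := Int.lt_ediv_add_one_mul_self _ hn'
    simp only [Finset.coe_product, Set.mem_prod, Finset.mem_coe, sqrtsMod, Finset.mem_filter,
      Finset.mem_Ico, Finset.mem_Icc]
    refine ⟨⟨⟨Int.emod_nonneg _ hn'.ne', Int.emod_lt_of_pos _ hn'⟩, ?_⟩, ?_, ?_⟩
    · rw [Int.emod_def]
      have : (u - n * (u / n)) ^ 2 - c =
          (u ^ 2 - c) + n * (-2 * u * (u / n) + n * (u / n) ^ 2) := by
        ring
      rw [this]
      exact dvd_add h2 (dvd_mul_right _ _)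
    · rw [Int.le_ediv_iff_mul_le hn']; push_cast; nlinarith
    · push_cast; exact Int.ediv_le_ediv hn' h1.2
  · intro u _ u' _ heq
    simp only [Prod.mk.injEq] at heq
    rw [← Int.mul_ediv_add_emod u n, ← Int.mul_ediv_add_emod u' n, heq.1, heq.2]

theorem two_mul_le_of_pell {d N u₁ u₂ v₁ v₂ : ℤ} (hd : 2 ≤ |d|) (hN : N ≠ 0)
    (hu₁ : 0 ≤ u₁) (hu₂ : 0 ≤ u₂) (hv₁ : 0 < v₁) (h₁ : u₁ ^ 2 - d * v₁ ^ 2 = N)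
    (h₂ : u₂ ^ 2 - d * v₂ ^ 2 = N) (hx : N ∣ u₁ * u₂ - d * (v₁ * v₂))
    (hy : N ∣ v₂ * u₁ - u₂ * v₁) (hlt : v₁ < v₂) : 2 * v₁ ≤ v₂ := by
  obtain ⟨x, hx⟩ := hx
  obtain ⟨y, hy⟩ := hy
  have hv₂ : 0 < v₂ := hv₁.trans hlt
  have hyv : y * (v₂ * u₁ + u₂ * v₁) = v₂ ^ 2 - v₁ ^ 2 := by
    apply mul_left_cancel₀ hN
    calc N * (y * (v₂ * u₁ + u₂ * v₁)) = (N * y) * (v₂ * u₁ + u₂ * v₁) := by ring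
      _ = v₂ ^ 2 * (u₁ ^ 2 - d * v₁ ^ 2) - v₁ ^ 2 * (u₂ ^ 2 - d * v₂ ^ 2) := by rw [← hy]; ring
      _ = N * (v₂ ^ 2 - v₁ ^ 2) := by rw [h₁, h₂]; ring
  have hy0 : 0 < y := by
    by_contra hneg
    have h3 : 0 ≤ v₂ * u₁ + u₂ * v₁ := by positivity
    nlinarith
  have hunit : x ^ 2 = 1 + d * y ^ 2 := by
    apply mul_left_cancel₀ (pow_ne_zero 2 hN)
    calc N ^ 2 * x ^ 2 = (N * x) ^ 2 := by ring
      _ = (u₁ ^ 2 - d * v₁ ^ 2) * (u₂ ^ 2 - d * v₂ ^ 2) + d * (v₂ * u₁ - u₂ * v₁) ^ 2 := by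
        rw [← hx]; ring
      _ = N ^ 2 * (1 + d * y ^ 2) := by rw [h₁, h₂, hy]; ring
  have hd2 : 2 ≤ d := by
    rcases le_abs.1 hd with h | h
    · exact h
    · nlinarith [sq_nonneg x, sq_nonneg (y - 1)]
  have hx0 : 0 < x := by
    rcases lt_or_gt_of_ne hN with hneg | hpos
    · have h3 : u₁ * u₂ < d * (v₁ * v₂) := by
        apply lt_of_pow_lt_pow_left₀ 2 (by positivity)
        have h4 : u₁ ^ 2 < d * v₁ ^ 2 := by linarith
        have h5 : u₂ ^ 2 < d * v₂ ^ 2 := by linarith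
        calc (u₁ * u₂) ^ 2 = u₁ ^ 2 * u₂ ^ 2 := by ring
          _ < (d * v₁ ^ 2) * (d * v₂ ^ 2) := mul_lt_mul'' h4 h5 (by positivity) (by positivity)
          _ = _ := by ring
      nlinarith
    · have h3 : d * (v₁ * v₂) < u₁ * u₂ := by
        apply lt_of_pow_lt_pow_left₀ 2 (by positivity)
        have h4 : d * v₁ ^ 2 < u₁ ^ 2 := by linarith
        have h5 : d * v₂ ^ 2 < u₂ ^ 2 := by linarith
        calc (d * (v₁ * v₂)) ^ 2 = (d * v₁ ^ 2) * (d * v₂ ^ 2) := by ring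
          _ < u₁ ^ 2 * u₂ ^ 2 := mul_lt_mul'' h4 h5 (by positivity) (by positivity)
          _ = _ := by ring
      nlinarith
  have hx2 : 2 ≤ x := by nlinarith
  have hv : v₂ = x * v₁ + y * u₁ := by
    apply mul_left_cancel₀ hN
    calc N * v₂ = (u₁ ^ 2 - d * v₁ ^ 2) * v₂ := by rw [h₁]
      _ = (u₁ * u₂ - d * (v₁ * v₂)) * v₁ + (v₂ * u₁ - u₂ * v₁) * u₁ := by ring
      _ = _ := by rw [hx, hy]; ring
  have : 0 ≤ y * u₁ := by positivity
  nlinarith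

theorem eq_of_pell_of_log_eq {d N r u₁ u₂ v₁ v₂ : ℤ} (hd : 2 ≤ |d|) (hN : N ≠ 0)
    (hu : 0 ≤ u₁ ↔ 0 ≤ u₂) (hv₁ : 0 < v₁) (hv₂ : 0 < v₂) (h₁ : u₁ ^ 2 - d * v₁ ^ 2 = N)
    (h₂ : u₂ ^ 2 - d * v₂ ^ 2 = N) (hr : N ∣ r ^ 2 - d) (hr₁ : N ∣ u₁ - r * v₁)
    (hr₂ : N ∣ u₂ - r * v₂) (hlog : Nat.log 2 v₁.toNat = Nat.log 2 v₂.toNat) : u₁ = u₂ := by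
  have key : ∀ {a b : ℤ}, 0 < a → 2 * a ≤ b → Nat.log 2 a.toNat ≠ Nat.log 2 b.toNat := by
    intro a b ha hab heq
    have h3 : Nat.log 2 (a.toNat * 2) = Nat.log 2 a.toNat + 1 :=
      Nat.log_mul_base (by norm_num) (by omega)
    have h4 : Nat.log 2 (a.toNat * 2) ≤ Nat.log 2 b.toNat := Nat.log_mono_right (by omega)
    omega
  have hx : N ∣ u₁ * u₂ - d * (v₁ * v₂) := by
    obtain ⟨a, ha⟩ := hr₁
    obtain ⟨b, hb⟩ := hr₂
    obtain ⟨c, hc⟩ := hr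
    refine ⟨a * u₂ + r * v₁ * b + c * (v₁ * v₂), ?_⟩
    linear_combination u₂ * ha + r * v₁ * hb + v₁ * v₂ * hc
  have hy : N ∣ v₂ * u₁ - u₂ * v₁ := by
    obtain ⟨a, ha⟩ := hr₁
    obtain ⟨b, hb⟩ := hr₂
    exact ⟨v₂ * a - v₁ * b, by linear_combination v₂ * ha - v₁ * hb⟩
  have hx' : N ∣ u₂ * u₁ - d * (v₂ * v₁) := by rwa [mul_comm u₂, mul_comm v₂]
  have hy' : N ∣ v₁ * u₂ - u₁ * v₂ := by
    rw [← dvd_neg]; exact hy.trans (dvd_of_eq (by ring))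
  have hveq : v₁ = v₂ := by
    rcases lt_trichotomy v₁ v₂ with h | h | h
    · refine absurd hlog (key hv₁ ?_)
      by_cases h0 : 0 ≤ u₁
      · exact two_mul_le_of_pell hd hN h0 (hu.1 h0) hv₁ h₁ h₂ hx hy h
      · have h0' : ¬ 0 ≤ u₂ := fun h => h0 (hu.2 h)
        refine two_mul_le_of_pell (u₁ := -u₁) (u₂ := -u₂) hd hN (by omega) (by omega) hv₁
          (by rw [← h₁]; ring) (by rw [← h₂]; ring) (hx.trans (dvd_of_eq (by ring))) ?_ h
        rw [← dvd_neg]; exact hy.trans (dvd_of_eq (by ring))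
    · exact h
    · refine absurd hlog.symm (key hv₂ ?_)
      by_cases h0 : 0 ≤ u₁
      · exact two_mul_le_of_pell hd hN (hu.1 h0) h0 hv₂ h₂ h₁ hx' hy' h
      · have h0' : ¬ 0 ≤ u₂ := fun h => h0 (hu.2 h)
        refine two_mul_le_of_pell (u₁ := -u₂) (u₂ := -u₁) hd hN (by omega) (by omega) hv₂
          (by rw [← h₂]; ring) (by rw [← h₁]; ring) (hx'.trans (dvd_of_eq (by ring))) ?_ h
        rw [← dvd_neg]; exact hy'.trans (dvd_of_eq (by ring))
  have hsq : u₁ ^ 2 = u₂ ^ 2 := by rw [hveq] at h₁; linarith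
  rcases sq_eq_sq_iff_eq_or_eq_neg.1 hsq with h | h <;> omega

theorem exists_primitive_pell {d N u v : ℤ} (hN : N ≠ 0) (hv : 0 < v)
    (h : u ^ 2 - d * v ^ 2 = N) :
    ∃ (g : ℕ) (u' v' r N' : ℤ), 0 < g ∧ u = g * u' ∧ 0 < v' ∧ v' ≤ v ∧ N = (g : ℤ) ^ 2 * N' ∧
      u' ^ 2 - d * v' ^ 2 = N' ∧ r ∈ sqrtsMod d N'.natAbs ∧ N' ∣ u' - r * v' := by
  have hg : 0 < Int.gcd u v := Int.gcd_pos_of_ne_zero_right _ hv.ne'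
  obtain ⟨u', v', hcop, hu', hv'⟩ := Int.exists_gcd_one hg
  set g := Int.gcd u v
  have hg' : (0 : ℤ) < g := by exact_mod_cast hg
  have hN' : N = (g : ℤ) ^ 2 * (u' ^ 2 - d * v' ^ 2) := by
    rw [← h]; nth_rewrite 1 [hu', hv']; ring
  have hv'0 : 0 < v' := by rw [hv'] at hv; exact pos_of_mul_pos_left hv hg'.le
  set N' := u' ^ 2 - d * v' ^ 2 with hN'def
  have hN'0 : N' ≠ 0 := by rintro h0; rw [h0] at hN'; simp at hN'; exact hN hN'
  have hcop' : IsCoprime v' (u' ^ 2) := (Int.isCoprime_iff_gcd_eq_one.2 hcop).symm.pow_right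
  obtain ⟨a, b, hab⟩ := hcop'.add_mul_left_right (-(d * v'))
  replace hab : a * v' + b * N' = 1 := by rw [hN'def]; linear_combination hab
  have hmod : N' ∣ u' * a - u' * a % N' := ⟨u' * a / N', by rw [Int.emod_def]; ring⟩
  have hroot : N' ∣ u' - (u' * a % N') * v' := by
    obtain ⟨k, hk⟩ := hmod
    exact ⟨u' * b + k * v', by linear_combination (-u') * hab + v' * hk⟩
  refine ⟨g, u', v', u' * a % N', N', hg, by rw [hu']; ring, hv'0, ?_, hN', rfl, ?_, hroot⟩
  · rw [hv']; nlinarith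
  · refine Finset.mem_filter.2 ⟨Finset.mem_Ico.2 ⟨Int.emod_nonneg _ hN'0, ?_⟩, ?_⟩
    · rw [Int.natCast_natAbs]; exact Int.emod_lt_abs _ hN'0
    · rw [Int.natCast_natAbs, abs_dvd]
      set r := u' * a % N'
      have h3 : N' ∣ v' ^ 2 * (r ^ 2 - d) := by
        obtain ⟨k, hk⟩ := hroot
        exact ⟨1 - k * (u' + r * v'), by linear_combination (-(u' + r * v')) * hk + hN'def⟩
      exact (IsCoprime.symm ⟨a, b, hab⟩ : IsCoprime N' v').pow_right.dvd_of_dvd_mul_left h3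

theorem card_pell_le {d N : ℤ} (hd : 2 ≤ |d|) (hN : N ≠ 0) (V G : ℕ)
    (hG : ∀ n : ℕ, ∑ g ∈ sqDivs d n, g ≤ G) (S : Finset ℤ)
    (hS : ∀ u ∈ S, ∃ v : ℤ, 0 < v ∧ v ≤ V ∧ u ^ 2 - d * v ^ 2 = N) :
    S.card ≤ G * N.natAbs.divisors.card * (2 * (Nat.log 2 V + 1)) * N.natAbs.divisors.card := by
  have hS' : ∀ u ∈ S, ∃ (g : ℕ) (u' v' r N' : ℤ), 0 < g ∧ u = g * u' ∧ 0 < v' ∧ v' ≤ V ∧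
      N = (g : ℤ) ^ 2 * N' ∧ u' ^ 2 - d * v' ^ 2 = N' ∧ r ∈ sqrtsMod d N'.natAbs ∧
      N' ∣ u' - r * v' := by
    intro u hu
    obtain ⟨v, hv0, hvV, h⟩ := hS u hu
    obtain ⟨g, u', v', r, N', h1, h2, h3, h4, h5⟩ := exists_primitive_pell hN hv0 h
    exact ⟨g, u', v', r, N', h1, h2, h3, h4.trans hvV, h5⟩
  choose! g u' v' r N' hg hu hv hvV hNN hpell hr hdvd using hS'
  have hN0 : N.natAbs ≠ 0 := Int.natAbs_ne_zero.2 hN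
  refine Finset.card_le_mul_card_image_of_maps_to (f := g) (fun u hu => ?_) _ fun k _ => ?_
  · refine Nat.mem_divisors.2 ⟨?_, hN0⟩
    rw [← Int.natCast_dvd, hNN u hu, sq, mul_assoc]
    exact dvd_mul_right _ _
  rcases (S.filter fun u => g u = k).eq_empty_or_nonempty with h0 | ⟨t, ht⟩
  · rw [h0]; simp
  obtain ⟨htS, htk⟩ := Finset.mem_filter.1 ht
  have hk0 : (k : ℤ) ≠ 0 := by rw [← htk]; exact_mod_cast (hg t htS).ne'
  have hN't : N' t ≠ 0 := by
    intro h0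
    have := hNN t htS
    rw [h0] at this
    simp at this
    exact hN this
  have hNeq : ∀ u ∈ S.filter fun u => g u = k, N' u = N' t := by
    intro u hu
    obtain ⟨huS, huk⟩ := Finset.mem_filter.1 hu
    have h1 := hNN u huS
    rw [hNN t htS, huk, htk] at h1
    exact (mul_left_cancel₀ (pow_ne_zero 2 hk0) h1).symm
  have hcard : (sqrtsMod d (N' t).natAbs ×ˢ ((Finset.univ : Finset Bool) ×ˢ
      Finset.range (Nat.log 2 V + 1))).card ≤
      G * N.natAbs.divisors.card * (2 * (Nat.log 2 V + 1)) := by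
    rw [Finset.card_product, Finset.card_product, Finset.card_univ, Fintype.card_bool,
      Finset.card_range]
    refine Nat.mul_le_mul_right _ ((card_sqrtsMod_le d (Int.natAbs_pos.2 hN't)).trans ?_)
    refine Nat.mul_le_mul (hG _) (Finset.card_le_card (Nat.divisors_subset_of_dvd hN0 ?_))
    rw [Int.natAbs_dvd_natAbs, hNN t htS]
    exact dvd_mul_left _ _
  refine le_trans ?_ hcard
  refine Finset.card_le_card_of_injOn
    (fun u => (r u, decide (0 ≤ u' u), Nat.log 2 (v' u).toNat)) ?_ ?_
  · intro u hu
    have huS := (Finset.mem_filter.1 hu).1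
    simp only [Finset.coe_product, Set.mem_prod, Finset.mem_coe, Finset.mem_univ, true_and,
      Finset.mem_range, Nat.lt_succ_iff]
    refine ⟨hNeq u hu ▸ hr u huS, Nat.log_mono_right ?_⟩
    have := hvV u huS
    omega
  · intro u hu₁ w hw₁ heq
    have huS := Finset.mem_filter.1 hu₁
    have hwS := Finset.mem_filter.1 hw₁
    simp only [Prod.mk.injEq, decide_eq_decide] at heq
    obtain ⟨h1, h2, h3⟩ := heq
    have hroot : N' t ∣ r u ^ 2 - d := by
      have := (Finset.mem_filter.1 (hr u huS.1)).2
      rwa [Int.natCast_natAbs, abs_dvd, hNeq u hu₁] at this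
    have : u' u = u' w := eq_of_pell_of_log_eq hd hN't h2 (hv u huS.1) (hv w hwS.1)
      ((hpell u huS.1).trans (hNeq u hu₁)) ((hpell w hwS.1).trans (hNeq w hw₁)) hroot
      (hNeq u hu₁ ▸ hdvd u huS.1) (h1 ▸ hNeq w hw₁ ▸ hdvd w hwS.1) h3
    rw [hu u huS.1, hu w hwS.1, this, huS.2, hwS.2]

theorem dvd_of_sq_dvd_mul_squarefree {m : ℤ} (hm : Squarefree m) {c g : ℕ} (hc : c ≠ 0)
    (h : (g : ℤ) ^ 2 ∣ c * m) : g ∣ c := by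
  obtain ⟨k, g', c', hk, hcop, hg, hc'⟩ :=
    Nat.exists_coprime' (Nat.gcd_pos_of_pos_right g (Nat.pos_of_ne_zero hc))
  have hk0 : (k : ℤ) ≠ 0 := by exact_mod_cast hk.ne'
  have h1 : (g' : ℤ) ^ 2 ∣ c' * m := by
    have h2 : (k : ℤ) * (k * (g' : ℤ) ^ 2) ∣ k * (c' * m) := by
      refine (dvd_of_eq ?_).trans (h.trans (dvd_of_eq ?_))
      · rw [hg]; push_cast; ring
      · rw [hc']; push_cast; ring
    exact (dvd_mul_left _ _).trans (Int.dvd_of_mul_dvd_mul_left hk0 h2)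
  have h3 : (g' : ℤ) ^ 2 ∣ m :=
    ((Nat.isCoprime_iff_coprime.2 hcop).pow_left).dvd_of_dvd_mul_left h1
  have h4 : IsUnit (g' : ℤ) := hm _ (by rwa [sq] at h3)
  have h5 : g' = 1 := by simpa [Int.isUnit_iff_natAbs_eq] using h4
  rw [hg, hc', h5, one_mul]
  exact dvd_mul_left _ _

theorem twentySeven_mul_discAB (A B : ℤ) :
    27 * discAB A B = -1728 * A ^ 3 - (108 * B) ^ 2 := by
  rw [discAB]; ring

theorem sum_sqDivs_le {m : ℤ} (hm : Squarefree m) (n : ℕ) :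
    ∑ g ∈ sqDivs (-27 * m) n, g ≤ 5886 := by
  calc ∑ g ∈ sqDivs (-27 * m) n, g ≤ ∑ g ∈ Finset.range 109, g := by
        refine Finset.sum_le_sum_of_subset fun g hg => ?_
        have h1 := (Finset.mem_filter.1 hg).2.2
        have h2 : g ∣ 108 := by
          refine dvd_of_sq_dvd_mul_squarefree hm (by norm_num) ?_
          rw [← dvd_neg]
          exact h1.trans (dvd_of_eq (by push_cast; ring))
        have := Nat.le_of_dvd (by norm_num) h2
        rw [Finset.mem_range]; omega
    _ = 5886 := by rw [Finset.sum_range_id]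

open Classical in
theorem card_discAB_eq_squarefree_mul_sq_le {A m : ℤ} (hA : A ≠ 0) (hm : Squarefree m)
    (b V : ℕ) :
    ((Finset.Icc (-b : ℤ) b).filter fun B =>
      ∃ l : ℤ, 0 < l ∧ l ≤ V ∧ discAB A B = m * l ^ 2).card ≤
    5886 * (1728 * A.natAbs ^ 3).divisors.card * (2 * (Nat.log 2 V + 1)) *
      (1728 * A.natAbs ^ 3).divisors.card := by
  have hN : (-1728 * A ^ 3) ≠ 0 := by positivity
  have hNabs : (-1728 * A ^ 3).natAbs = 1728 * A.natAbs ^ 3 := by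
    rw [Int.natAbs_mul, Int.natAbs_pow]; rfl
  have hd : 2 ≤ |-27 * m| := by
    have : 1 ≤ |m| := Int.one_le_abs hm.ne_zero
    rw [abs_mul]; norm_num; omega
  rw [← hNabs, ← Finset.card_image_of_injective (f := fun B : ℤ => 108 * B) _
    (fun x y h => by simpa using h)]
  refine card_pell_le hd hN V 5886 (sum_sqDivs_le hm) _ fun u hu => ?_
  obtain ⟨B, hB, rfl⟩ := Finset.mem_image.1 hu
  obtain ⟨_, l, hl0, hlV, hl⟩ := Finset.mem_filter.1 hB
  refine ⟨l, hl0, hlV, ?_⟩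
  have := twentySeven_mul_discAB A B
  rw [hl] at this
  linear_combination this

open Classical in
theorem card_large_sqPart_le (a b V M K : ℕ)
    (hK : ∀ n, n ≠ 0 → n ≤ 1728 * a ^ 3 → n.divisors.card ≤ K) :
    ((Finset.Icc (-a : ℤ) a ×ˢ Finset.Icc (-b : ℤ) b).filter fun p => p.1 ≠ 0 ∧
      ∃ m l : ℤ, Squarefree m ∧ |m| ≤ M ∧ 0 < l ∧ l ≤ V ∧ discAB p.1 p.2 = m * l ^ 2).card ≤
    (2 * a + 1) * (2 * M + 1) * (5886 * K * (2 * (Nat.log 2 V + 1)) * K) := by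
  classical
  have hsub : ((Finset.Icc (-a : ℤ) a ×ˢ Finset.Icc (-b : ℤ) b).filter fun p => p.1 ≠ 0 ∧
      ∃ m l : ℤ, Squarefree m ∧ |m| ≤ M ∧ 0 < l ∧ l ≤ V ∧ discAB p.1 p.2 = m * l ^ 2) ⊆
      ((Finset.Icc (-a : ℤ) a ×ˢ Finset.Icc (-M : ℤ) M).filter fun q =>
        q.1 ≠ 0 ∧ Squarefree q.2).biUnion fun q =>
        ((Finset.Icc (-b : ℤ) b).filter fun B =>
          ∃ l : ℤ, 0 < l ∧ l ≤ V ∧ discAB q.1 B = q.2 * l ^ 2).image fun B => (q.1, B) := by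
    intro p hp
    obtain ⟨hp1, hA, m, l, hm, hmM, hl0, hlV, h⟩ := Finset.mem_filter.1 hp
    rw [Finset.mem_product] at hp1
    refine Finset.mem_biUnion.2 ⟨(p.1, m), Finset.mem_filter.2 ⟨Finset.mem_product.2
      ⟨hp1.1, Finset.mem_Icc.2 (abs_le.1 hmM)⟩, hA, hm⟩, Finset.mem_image.2 ⟨p.2, ?_, rfl⟩⟩
    exact Finset.mem_filter.2 ⟨hp1.2, l, hl0, hlV, h⟩
  refine (Finset.card_le_card hsub).trans ((Finset.card_biUnion_le_card_mul _ _
    (5886 * K * (2 * (Nat.log 2 V + 1)) * K) fun q hq => ?_).trans ?_)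
  · obtain ⟨hq1, hA, hm⟩ := Finset.mem_filter.1 hq
    have hq1 := Finset.mem_Icc.1 (Finset.mem_product.1 hq1).1
    have hτ : (1728 * q.1.natAbs ^ 3).divisors.card ≤ K := by
      refine hK _ (by positivity) ?_
      gcongr
      omega
    refine Finset.card_image_le.trans ((card_discAB_eq_squarefree_mul_sq_le hA hm b V).trans ?_)
    gcongr
  · refine Nat.mul_le_mul_right _ ((Finset.card_filter_le _ _).trans ?_)
    rw [Finset.card_product, Int.card_Icc, Int.card_Icc]
    exact le_of_eq (by congr 1 <;> omega)

theorem sum_multiples_le (b z s : ℕ) {g : ℕ} (hg : 0 < g) :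
    ∑ l ∈ (Finset.Ioc z s).filter (g ∣ ·), (g : ℝ) * (216 * (b : ℝ) / (l : ℝ) ^ 2 + 2) ≤
      432 * (b : ℝ) / (z + 1) + 2 * s := by
  have hg' : (0 : ℝ) < g := by exact_mod_cast hg
  have hsub : (Finset.Ioc z s).filter (g ∣ ·) ⊆
      (Finset.Ioo (z / g) (s / g + 1)).image (g * ·) := by
    intro l hl
    obtain ⟨hl1, k, rfl⟩ := Finset.mem_filter.1 hl
    rw [Finset.mem_Ioc] at hl1
    refine Finset.mem_image.2 ⟨k, Finset.mem_Ioo.2 ⟨?_, ?_⟩, rfl⟩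
    · rw [Nat.div_lt_iff_lt_mul hg, mul_comm]; exact hl1.1
    · rw [Nat.lt_succ_iff, Nat.le_div_iff_mul_le hg, mul_comm]; exact hl1.2
  calc ∑ l ∈ (Finset.Ioc z s).filter (g ∣ ·), (g : ℝ) * (216 * (b : ℝ) / (l : ℝ) ^ 2 + 2)
      ≤ ∑ l ∈ (Finset.Ioo (z / g) (s / g + 1)).image (g * ·),
          (g : ℝ) * (216 * (b : ℝ) / (l : ℝ) ^ 2 + 2) :=
        Finset.sum_le_sum_of_subset_of_nonneg hsub fun _ _ _ => by positivity
    _ = ∑ k ∈ Finset.Ioo (z / g) (s / g + 1),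
          (g : ℝ) * (216 * (b : ℝ) / ((g * k : ℕ) : ℝ) ^ 2 + 2) :=
        Finset.sum_image fun x _ y _ h => Nat.eq_of_mul_eq_mul_left hg h
    _ = 216 * b / g * ∑ k ∈ Finset.Ioo (z / g) (s / g + 1), ((k : ℝ) ^ 2)⁻¹ +
          (Finset.Ioo (z / g) (s / g + 1)).card * (2 * g) := by
        rw [Finset.mul_sum, ← nsmul_eq_mul, ← Finset.sum_const, ← Finset.sum_add_distrib]
        refine Finset.sum_congr rfl fun k hk => ?_
        have hk0 : (0 : ℝ) < k := by
          have := (Finset.mem_Ioo.1 hk).1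
          exact_mod_cast (Nat.zero_le _).trans_lt this
        push_cast
        field_simp
    _ ≤ 216 * b / g * (2 / ((z / g : ℕ) + 1)) + (s / g : ℕ) * (2 * g) := by
        gcongr
        · exact sum_Ioo_inv_sq_le _ _
        · rw [Nat.card_Ioo]
          exact Nat.sub_le_of_le_add (by have := Nat.zero_le (z / g); lia)
    _ ≤ 432 * (b : ℝ) / (z + 1) + 2 * s := by
        gcongr ?_ + ?_
        · have h1 : (z + 1 : ℝ) ≤ g * ((z / g : ℕ) + 1) := by
            have := Nat.lt_mul_div_succ z hg
            exact_mod_cast this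
          calc 216 * b / g * (2 / (((z / g : ℕ) : ℝ) + 1))
              = 432 * b / (g * ((z / g : ℕ) + 1)) := by field_simp; ring
            _ ≤ _ := by gcongr
        · have : ((s / g * g : ℕ) : ℝ) ≤ s := by exact_mod_cast Nat.div_mul_le_self s g
          push_cast at this
          linarith

theorem sum_card_sq_dvd_discAB_le {A : ℤ} (hA : A ≠ 0) (b z s K : ℕ)
    (hK : (6912 * A.natAbs ^ 3).divisors.card ≤ K)
    (hK' : ∀ l ∈ Finset.Ioc z s, (l ^ 2).divisors.card ≤ K) :
    ∑ l ∈ Finset.Ioc z s, (((Finset.Icc (-b : ℤ) b).filter fun B =>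
      ((l ^ 2 : ℕ) : ℤ) ∣ discAB A B).card : ℝ) ≤
      (K : ℝ) * ((K : ℝ) * (432 * (b : ℝ) / (z + 1) + 2 * s)) := by
  set D := (6912 * A.natAbs ^ 3).divisors with hD
  set c : ℤ := -1728 * A ^ 3 with hc
  have hD0 : 6912 * A.natAbs ^ 3 ≠ 0 := by positivity
  have hterm : ∀ l ∈ Finset.Ioc z s, (((Finset.Icc (-b : ℤ) b).filter fun B =>
      ((l ^ 2 : ℕ) : ℤ) ∣ discAB A B).card : ℝ) ≤
      K * ∑ g ∈ D, if g ∣ l then (g : ℝ) * (216 * (b : ℝ) / (l : ℝ) ^ 2 + 2) else 0 := by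
    intro l hl
    have hl0 : 0 < l := by have := (Finset.mem_Ioc.1 hl).1; omega
    have hl2 : 0 < l ^ 2 := by positivity
    have h1 : ((Finset.Icc (-b : ℤ) b).filter fun B => ((l ^ 2 : ℕ) : ℤ) ∣ discAB A B).card ≤
        (∑ g ∈ sqDivs c (l ^ 2), g) * (l ^ 2).divisors.card * (2 * (108 * b / l ^ 2) + 2) := by
      refine le_trans ?_ ((card_filter_dvd_sq_sub_le c (108 * b) hl2).trans
        (Nat.mul_le_mul_right _ (card_sqrtsMod_le c hl2)))
      refine Finset.card_le_card_of_injOn (fun B => 108 * B) (fun B hB => ?_)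
        (fun x _ y _ h => by simpa using h)
      obtain ⟨hB1, hB2⟩ := Finset.mem_filter.1 hB
      rw [Finset.mem_Icc] at hB1
      refine Finset.mem_coe.2 (Finset.mem_filter.2 ⟨Finset.mem_Icc.2 ⟨?_, ?_⟩, ?_⟩)
      · push_cast; omega
      · push_cast; omega
      · rw [← dvd_neg]
        refine (hB2.mul_left 27).trans (dvd_of_eq ?_)
        rw [twentySeven_mul_discAB]; ring
    have h2 : ((108 * b / l ^ 2 : ℕ) : ℝ) ≤ 108 * b / (l : ℝ) ^ 2 := by
      refine Nat.cast_div_le.trans (le_of_eq ?_)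
      push_cast; ring
    have h3 : ∑ g ∈ sqDivs c (l ^ 2), (g : ℝ) ≤ ∑ g ∈ D.filter (· ∣ l), (g : ℝ) := by
      refine Finset.sum_le_sum_of_subset_of_nonneg (fun g hg => ?_) fun _ _ _ => by positivity
      obtain ⟨_, hg1, hg2⟩ := Finset.mem_filter.1 hg
      refine Finset.mem_filter.2 ⟨Nat.mem_divisors.2 ⟨?_, hD0⟩, (Nat.pow_dvd_pow_iff two_ne_zero).1
        hg1⟩
      have h4 : (g : ℤ) ∣ 4 * c := (dvd_pow_self _ two_ne_zero).trans hg2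
      rw [Int.natCast_dvd] at h4
      refine h4.trans (dvd_of_eq ?_)
      rw [hc, ← mul_assoc, Int.natAbs_mul, Int.natAbs_pow]; rfl
    calc (((Finset.Icc (-b : ℤ) b).filter fun B =>
          ((l ^ 2 : ℕ) : ℤ) ∣ discAB A B).card : ℝ)
        ≤ (∑ g ∈ sqDivs c (l ^ 2), (g : ℝ)) * (l ^ 2).divisors.card *
            (2 * ((108 * b / l ^ 2 : ℕ) : ℝ) + 2) := by
          refine (Nat.cast_le.2 h1).trans (le_of_eq ?_)
          rw [Nat.cast_mul, Nat.cast_mul, Nat.cast_sum, Nat.cast_add, Nat.cast_mul, Nat.cast_ofNat]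
      _ ≤ (∑ g ∈ D.filter (· ∣ l), (g : ℝ)) * K * (2 * (108 * b / (l : ℝ) ^ 2) + 2) := by
          gcongr
          · exact hK' l hl
      _ = K * ∑ g ∈ D.filter (· ∣ l), (g : ℝ) * (216 * (b : ℝ) / (l : ℝ) ^ 2 + 2) := by
          rw [← Finset.sum_mul]; ring
      _ = _ := by rw [Finset.sum_filter]
  calc _ ≤ ∑ l ∈ Finset.Ioc z s, (K : ℝ) * ∑ g ∈ D,
          (if g ∣ l then (g : ℝ) * (216 * (b : ℝ) / (l : ℝ) ^ 2 + 2) else 0) :=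
        Finset.sum_le_sum hterm
    _ = (K : ℝ) * ∑ g ∈ D, ∑ l ∈ (Finset.Ioc z s).filter (g ∣ ·),
          (g : ℝ) * (216 * (b : ℝ) / (l : ℝ) ^ 2 + 2) := by
        rw [← Finset.mul_sum, Finset.sum_comm]
        simp_rw [Finset.sum_filter]
    _ ≤ (K : ℝ) * ∑ g ∈ D, (432 * (b : ℝ) / (z + 1) + 2 * s : ℝ) := by
        gcongr with g hg
        exact sum_multiples_le b z s (Nat.pos_of_mem_divisors hg)
    _ ≤ _ := by
        rw [Finset.sum_const, nsmul_eq_mul]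
        gcongr

theorem card_medium_sqPart_le (a b z s K : ℕ)
    (hK : ∀ n, n ≠ 0 → n ≤ 6912 * a ^ 3 → n.divisors.card ≤ K)
    (hK' : ∀ l ∈ Finset.Ioc z s, (l ^ 2).divisors.card ≤ K) :
    (((Finset.Icc (-a : ℤ) a ×ˢ Finset.Icc (-b : ℤ) b).filter fun p => p.1 ≠ 0 ∧
      ∃ l ∈ Finset.Ioc z s, ((l ^ 2 : ℕ) : ℤ) ∣ discAB p.1 p.2).card : ℝ) ≤
    (2 * a + 1) * (K * ((K : ℝ) * (432 * (b : ℝ) / (z + 1) + 2 * s))) := by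
  classical
  have hsub : ((Finset.Icc (-a : ℤ) a ×ˢ Finset.Icc (-b : ℤ) b).filter fun p => p.1 ≠ 0 ∧
      ∃ l ∈ Finset.Ioc z s, ((l ^ 2 : ℕ) : ℤ) ∣ discAB p.1 p.2) ⊆
      ((Finset.Icc (-a : ℤ) a).filter (· ≠ 0)).biUnion fun A =>
        (Finset.Ioc z s).biUnion fun l => ((Finset.Icc (-b : ℤ) b).filter fun B =>
          ((l ^ 2 : ℕ) : ℤ) ∣ discAB A B).image fun B => (A, B) := by
    intro p hp
    obtain ⟨hp1, hA, l, hl, h⟩ := Finset.mem_filter.1 hp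
    rw [Finset.mem_product] at hp1
    exact Finset.mem_biUnion.2 ⟨p.1, Finset.mem_filter.2 ⟨hp1.1, hA⟩, Finset.mem_biUnion.2
      ⟨l, hl, Finset.mem_image.2 ⟨p.2, Finset.mem_filter.2 ⟨hp1.2, h⟩, rfl⟩⟩⟩
  have hnat := (Finset.card_le_card hsub).trans Finset.card_biUnion_le
  calc _ ≤ ((∑ A ∈ (Finset.Icc (-a : ℤ) a).filter (· ≠ 0), ((Finset.Ioc z s).biUnion fun l =>
          ((Finset.Icc (-b : ℤ) b).filter fun B =>
          ((l ^ 2 : ℕ) : ℤ) ∣ discAB A B).image fun B => (A, B)).card : ℕ) : ℝ) := by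
        exact_mod_cast hnat
    _ ≤ ∑ A ∈ (Finset.Icc (-a : ℤ) a).filter (· ≠ 0),
          (K * ((K : ℝ) * (432 * (b : ℝ) / (z + 1) + 2 * s)) : ℝ) := by
        push_cast
        refine Finset.sum_le_sum fun A hA => ?_
        obtain ⟨hA1, hA0⟩ := Finset.mem_filter.1 hA
        rw [Finset.mem_Icc] at hA1
        refine le_trans ?_ (sum_card_sq_dvd_discAB_le hA0 b z s K
          (hK _ (by positivity) (by gcongr; omega)) hK')
        exact_mod_cast Finset.card_biUnion_le.trans
          (Finset.sum_le_sum fun l _ => Finset.card_image_le)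
    _ ≤ _ := by
        rw [Finset.sum_const, nsmul_eq_mul]
        have : (((Finset.Icc (-a : ℤ) a).filter (· ≠ 0)).card : ℝ) ≤ 2 * a + 1 := by
          have h1 := Finset.card_filter_le (Finset.Icc (-a : ℤ) a) (· ≠ 0)
          rw [Int.card_Icc] at h1
          exact_mod_cast h1.trans (by omega)
        gcongr

theorem card_le_of_sub_le {S : Finset ℤ} {w : ℝ} (hw : 0 ≤ w)
    (h : ∀ x ∈ S, ∀ y ∈ S, ((y - x : ℤ) : ℝ) ≤ w) : (S.card : ℝ) ≤ w + 1 := by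
  rcases S.eq_empty_or_nonempty with rfl | hne
  · simp; linarith
  have hsub : S ⊆ Finset.Icc (S.min' hne) (S.min' hne + ⌊w⌋₊) := by
    intro y hy
    refine Finset.mem_Icc.2 ⟨S.min'_le y hy, ?_⟩
    have h1 := h _ (S.min'_mem hne) y hy
    have h2 : y - S.min' hne ≤ ⌊w⌋ := Int.le_floor.2 h1
    rw [← Int.natCast_floor_eq_floor hw] at h2
    linarith
  have h1 := Finset.card_le_card hsub
  rw [Int.card_Icc] at h1
  have h2 : S.card ≤ ⌊w⌋₊ + 1 := by omega
  calc (S.card : ℝ) ≤ (⌊w⌋₊ : ℝ) + 1 := by exact_mod_cast h2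
    _ ≤ w + 1 := by gcongr; exact Nat.floor_le hw

theorem sum_Ioc_inv_mul_sqrt_le {k : ℕ} (hk : 0 < k) (a : ℕ) :
    ∑ n ∈ Finset.Ioc k a, ((n : ℝ) * √n)⁻¹ ≤ 2 / √k := by
  rcases lt_or_ge a k with h | h
  · rw [Finset.Ioc_eq_empty_of_le h.le, Finset.sum_empty]
    positivity
  suffices H : ∑ n ∈ Finset.Ioc k a, ((n : ℝ) * √n)⁻¹ ≤ 2 / √k - 2 / √a by
    have : 0 ≤ 2 / √(a : ℝ) := by positivity
    linarith
  induction a, h using Nat.le_induction with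
  | base => simp
  | succ a ha ih =>
    rw [Finset.sum_Ioc_succ_top (by omega)]
    have ha0 : (0 : ℝ) < a := by exact_mod_cast hk.trans_le ha
    have key : (((a + 1 : ℕ) : ℝ) * √((a + 1 : ℕ) : ℝ))⁻¹ ≤ 2 / √a - 2 / √((a + 1 : ℕ) : ℝ) := by
      push_cast
      set t := √(a : ℝ) with ht
      set s := √((a : ℝ) + 1) with hs
      have ht0 : 0 < t := Real.sqrt_pos.2 ha0
      have hs0 : 0 < s := Real.sqrt_pos.2 (by linarith)
      have ht2 : t ^ 2 = a := Real.sq_sqrt ha0.le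
      have hs2 : s ^ 2 = a + 1 := Real.sq_sqrt (by linarith)
      have hts : t ≤ s := Real.sqrt_le_sqrt (by linarith)
      have hdiff : (s - t) * (s + t) = 1 := by nlinarith
      have e : 2 / t - 2 / s = 2 * ((s - t) * (s + t)) / (t * s * (s + t)) := by
        field_simp
      rw [← hs2, e, hdiff, inv_eq_one_div, div_le_div_iff₀ (by positivity) (by positivity)]
      have h1 : t * s * (s + t) ≤ s * s * (s + s) := by gcongr
      nlinarith
    linarith

theorem sum_Icc_neg_natAbs_le (f : ℕ → ℝ) (hf : ∀ n, 0 ≤ f n) (a : ℕ) :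
    ∑ A ∈ Finset.Icc (-a : ℤ) a, f A.natAbs ≤ 2 * ∑ n ∈ Finset.range (a + 1), f n := by
  classical
  have hsub : Finset.Icc (-a : ℤ) a ⊆ ((Finset.range (a + 1)).image fun n : ℕ => (n : ℤ)) ∪
      ((Finset.range (a + 1)).image fun n : ℕ => -(n : ℤ)) := by
    intro A hA
    rw [Finset.mem_Icc] at hA
    simp only [Finset.mem_union, Finset.mem_image, Finset.mem_range]
    rcases le_total 0 A with h | h
    · exact Or.inl ⟨A.natAbs, by omega, by omega⟩
    · exact Or.inr ⟨A.natAbs, by omega, by omega⟩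
  have hunion := Finset.sum_union_inter (s₁ := (Finset.range (a + 1)).image fun n : ℕ => (n : ℤ))
    (s₂ := (Finset.range (a + 1)).image fun n : ℕ => -(n : ℤ)) (f := fun A : ℤ => f A.natAbs)
  rw [Finset.sum_image (fun x _ y _ h => by simpa using h),
    Finset.sum_image (fun x _ y _ h => by simpa using h)] at hunion
  simp only [Int.natAbs_neg, Int.natAbs_natCast] at hunion
  have h1 := Finset.sum_le_sum_of_subset_of_nonneg hsub (f := fun A : ℤ => f A.natAbs)
    fun _ _ _ => hf _
  have h2 : 0 ≤ ∑ x ∈ ((Finset.range (a + 1)).image fun n : ℕ => (n : ℤ)) ∩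
      ((Finset.range (a + 1)).image fun n : ℕ => -(n : ℤ)), f x.natAbs :=
    Finset.sum_nonneg fun _ _ => hf _
  linarith

theorem card_abs_le_of_abs_cubic_le {A : ℤ} {Y : ℝ} (hY : 1 ≤ Y) (hA : |(A : ℝ)| ^ 3 ≤ Y)
    (S : Finset ℤ) (hS : ∀ B ∈ S, |4 * (A : ℝ) ^ 3 + 27 * (B : ℝ) ^ 2| ≤ Y) :
    (S.card : ℝ) ≤ 3 * √Y := by
  have hs1 : 1 ≤ √Y := Real.one_le_sqrt.2 hY
  have hsub : S ⊆ Finset.Icc (-⌊√Y⌋₊ : ℤ) ⌊√Y⌋₊ := by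
    intro B hB
    have h1 := (abs_le.1 (hS B hB)).2
    rw [← abs_pow] at hA
    have h2 := (abs_le.1 hA).1
    have h3 : |(B : ℝ)| ≤ √Y := Real.abs_le_sqrt (by nlinarith)
    have h4 : B.natAbs ≤ ⌊√Y⌋₊ := Nat.le_floor (by rwa [Nat.cast_natAbs, Int.cast_abs])
    rw [Finset.mem_Icc]; omega
  have h1 := Finset.card_le_card hsub
  rw [Int.card_Icc] at h1
  have h2 : S.card ≤ 2 * ⌊√Y⌋₊ + 1 := by omega
  have h3 : (⌊√Y⌋₊ : ℝ) ≤ √Y := Nat.floor_le (by positivity)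
  have h4 : (S.card : ℝ) ≤ 2 * ⌊√Y⌋₊ + 1 := by exact_mod_cast h2
  linarith

theorem card_le_of_lt_abs_cubic {A : ℤ} {Y : ℝ} (hY : 0 < Y) (hA : Y < |(A : ℝ)| ^ 3)
    (S : Finset ℤ) (hS : ∀ B ∈ S, |4 * (A : ℝ) ^ 3 + 27 * (B : ℝ) ^ 2| ≤ Y) :
    (S.card : ℝ) ≤ 2 * (Y * (|(A : ℝ)| * √|(A : ℝ)|)⁻¹ + 1) := by
  set n := |(A : ℝ)| with hn
  have hn0 : 0 < n := by
    by_contra h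
    have : n = 0 := le_antisymm (not_lt.1 h) (abs_nonneg _)
    rw [this] at hA; norm_num at hA; linarith
  set q := n * √n with hq
  have hq0 : 0 < q := by positivity
  have hq2 : q ^ 2 = n ^ 3 := by rw [hq, mul_pow, Real.sq_sqrt hn0.le]; ring
  have hlow : ∀ B ∈ S, q ≤ 3 * |(B : ℝ)| := by
    intro B hB
    refine le_of_sq_le_sq ?_ (by positivity)
    rw [hq2, mul_pow, sq_abs]
    have h1 := (abs_le.1 (hS B hB)).1
    have h2 := (abs_le.1 (hS B hB)).2
    rcases abs_choice ((A : ℝ) ^ 3) with h | h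
    · rw [abs_pow] at h; rw [← hn] at h; nlinarith [sq_nonneg (B : ℝ)]
    · rw [abs_pow] at h; rw [← hn] at h; nlinarith
  have key : ∀ x ∈ S, ∀ y ∈ S, q * (|(y : ℝ)| - |(x : ℝ)|) ≤ Y := by
    intro x hx y hy
    have h1 := (abs_le.1 (hS x hx)).1
    have h2 := (abs_le.1 (hS y hy)).2
    have h3 := hlow x hx
    have h4 := hlow y hy
    have h5 : 27 * ((|(y : ℝ)| - |(x : ℝ)|) * (|(y : ℝ)| + |(x : ℝ)|)) ≤ 2 * Y := by
      have : (|(y : ℝ)| - |(x : ℝ)|) * (|(y : ℝ)| + |(x : ℝ)|) = (y : ℝ) ^ 2 - (x : ℝ) ^ 2 := by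
        rw [← sq_abs (y : ℝ), ← sq_abs (x : ℝ)]; ring
      rw [this]; linarith
    rcases le_total |(y : ℝ)| |(x : ℝ)| with h | h
    · nlinarith
    · nlinarith
  have hw : 0 ≤ Y * q⁻¹ := by positivity
  have hpos : ((S.filter (0 ≤ ·)).card : ℝ) ≤ Y * q⁻¹ + 1 := by
    refine card_le_of_sub_le hw fun x hx y hy => ?_
    obtain ⟨hx, hx0⟩ := Finset.mem_filter.1 hx
    obtain ⟨hy, hy0⟩ := Finset.mem_filter.1 hy
    have := key x hx y hy
    rw [abs_of_nonneg (by exact_mod_cast hy0 : (0 : ℝ) ≤ y),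
      abs_of_nonneg (by exact_mod_cast hx0 : (0 : ℝ) ≤ x)] at this
    rw [← div_eq_mul_inv, le_div_iff₀ hq0]
    push_cast
    linarith
  have hneg : ((S.filter (¬ 0 ≤ ·)).card : ℝ) ≤ Y * q⁻¹ + 1 := by
    refine card_le_of_sub_le hw fun x hx y hy => ?_
    obtain ⟨hx, hx0⟩ := Finset.mem_filter.1 hx
    obtain ⟨hy, hy0⟩ := Finset.mem_filter.1 hy
    have := key y hy x hx
    rw [abs_of_nonpos (by exact_mod_cast (not_le.1 hx0).le : (x : ℝ) ≤ 0),
      abs_of_nonpos (by exact_mod_cast (not_le.1 hy0).le : (y : ℝ) ≤ 0)] at this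
    rw [← div_eq_mul_inv, le_div_iff₀ hq0]
    push_cast
    linarith
  have hsum := Finset.card_filter_add_card_filter_not (s := S) (0 ≤ ·)
  have hsum' : (S.card : ℝ) = (S.filter (0 ≤ ·)).card + (S.filter (¬ 0 ≤ ·)).card := by
    exact_mod_cast hsum.symm
  linarith

open Classical in
theorem card_small_disc_le {Y : ℝ} (hY : 1 ≤ Y) (a b : ℕ) :
    (((Finset.Icc (-a : ℤ) a ×ˢ Finset.Icc (-b : ℤ) b).filter fun p =>
      |4 * (p.1 : ℝ) ^ 3 + 27 * (p.2 : ℝ) ^ 2| ≤ Y).card : ℝ) ≤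
    28 * Y ^ (5 / 6 : ℝ) + 4 * a := by
  have hY0 : 0 < Y := by linarith
  set y := Y ^ (1 / 3 : ℝ) with hy
  have hy3 : y ^ 3 = Y := by
    rw [hy, ← Real.rpow_natCast, ← Real.rpow_mul hY0.le]; norm_num
  have hy1 : 1 ≤ y := Real.one_le_rpow hY (by norm_num)
  set k := ⌊y⌋₊ with hk
  have hk1 : 1 ≤ k := Nat.le_floor (by simpa using hy1)
  have hky : (k : ℝ) ≤ y := Nat.floor_le (by linarith)
  have hyk : y < k + 1 := Nat.lt_floor_add_one y
  set f : ℕ → ℝ := fun n => if n ≤ k then 3 * √Y else 2 * (Y * ((n : ℝ) * √n)⁻¹ + 1) with hf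
  have hf0 : ∀ n, 0 ≤ f n := fun n => by rw [hf]; dsimp only; split_ifs <;> positivity
  have hsub : ((Finset.Icc (-a : ℤ) a ×ˢ Finset.Icc (-b : ℤ) b).filter fun p =>
      |4 * (p.1 : ℝ) ^ 3 + 27 * (p.2 : ℝ) ^ 2| ≤ Y) ⊆
      (Finset.Icc (-a : ℤ) a).biUnion fun A => ((Finset.Icc (-b : ℤ) b).filter fun B : ℤ =>
        |4 * (A : ℝ) ^ 3 + 27 * (B : ℝ) ^ 2| ≤ Y).image fun B => (A, B) := by
    intro p hp
    obtain ⟨hp1, h⟩ := Finset.mem_filter.1 hp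
    rw [Finset.mem_product] at hp1
    exact Finset.mem_biUnion.2 ⟨p.1, hp1.1, Finset.mem_image.2
      ⟨p.2, Finset.mem_filter.2 ⟨hp1.2, h⟩, rfl⟩⟩
  have hfib : ∀ A : ℤ, (((Finset.Icc (-b : ℤ) b).filter fun B : ℤ =>
        |4 * (A : ℝ) ^ 3 + 27 * (B : ℝ) ^ 2| ≤ Y).card : ℝ) ≤ f A.natAbs := by
    intro A
    have hcast : ((A.natAbs : ℕ) : ℝ) = |(A : ℝ)| := by rw [Nat.cast_natAbs, Int.cast_abs]
    rw [hf]; dsimp only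
    split_ifs with h
    · refine card_abs_le_of_abs_cubic_le hY ?_ _ fun B hB => (Finset.mem_filter.1 hB).2
      rw [← hcast, ← hy3]
      have : ((A.natAbs : ℕ) : ℝ) ≤ k := by exact_mod_cast h
      exact pow_le_pow_left₀ (by positivity) (this.trans hky) 3
    · rw [hcast]
      refine card_le_of_lt_abs_cubic hY0 ?_ _ fun B hB => (Finset.mem_filter.1 hB).2
      rw [← hcast, ← hy3]
      have : (k : ℝ) + 1 ≤ (A.natAbs : ℕ) := by exact_mod_cast not_le.1 h
      exact pow_lt_pow_left₀ (hyk.trans_le this) (by linarith) three_ne_zero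
  have hsum : ∑ n ∈ Finset.range (a + 1), f n ≤
      (k + 1) * (3 * √Y) + ∑ n ∈ Finset.Ioc k a, 2 * (Y * ((n : ℝ) * √n)⁻¹ + 1) := by
    calc ∑ n ∈ Finset.range (a + 1), f n
        ≤ ∑ n ∈ Finset.range (k + 1) ∪ Finset.Ioc k a, f n := by
          refine Finset.sum_le_sum_of_subset_of_nonneg (fun n hn => ?_) fun _ _ _ => hf0 _
          rw [Finset.mem_range] at hn
          rw [Finset.mem_union, Finset.mem_range, Finset.mem_Ioc]
          omega
      _ = ∑ n ∈ Finset.range (k + 1), f n + ∑ n ∈ Finset.Ioc k a, f n := by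
          refine Finset.sum_union (Finset.disjoint_left.2 fun n h1 h2 => ?_)
          rw [Finset.mem_range] at h1
          rw [Finset.mem_Ioc] at h2
          omega
      _ = _ := by
          congr 1
          · rw [Finset.sum_congr rfl (g := fun _ => 3 * √Y), Finset.sum_const, Finset.card_range,
              nsmul_eq_mul]
            · push_cast; ring
            · intro n hn
              rw [Finset.mem_range] at hn
              exact if_pos (by omega)
          · refine Finset.sum_congr rfl fun n hn => ?_
            rw [Finset.mem_Ioc] at hn
            exact if_neg (by omega)
  have htail : ∑ n ∈ Finset.Ioc k a, 2 * (Y * ((n : ℝ) * √n)⁻¹ + 1) ≤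
      2 * (Y * (2 / √k)) + 2 * a := by
    rw [← Finset.mul_sum, Finset.sum_add_distrib, ← Finset.mul_sum, Finset.sum_const, Nat.card_Ioc,
      nsmul_eq_mul, mul_one]
    have h1 := sum_Ioc_inv_mul_sqrt_le hk1 a
    have h2 : ((a - k : ℕ) : ℝ) ≤ a := by exact_mod_cast Nat.sub_le a k
    have h3 := mul_le_mul_of_nonneg_left h1 hY0.le
    linarith
  set E := Y ^ (5 / 6 : ℝ) with hE
  have hE1 : y * √Y = E := by
    rw [hy, hE, Real.sqrt_eq_rpow, ← Real.rpow_add hY0]; norm_num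
  have hE2 : Y = E * √y := by
    rw [hy, hE, Real.sqrt_eq_rpow, ← Real.rpow_mul hY0.le, ← Real.rpow_add hY0]; norm_num
  have hE0 : 0 < E := by positivity
  have hk' : Y * (2 / √k) ≤ 4 * E := by
    have hkpos : 0 < √(k : ℝ) := Real.sqrt_pos.2 (by exact_mod_cast hk1)
    have h1 : √y ≤ 2 * √(k : ℝ) := by
      have h2 : (1 : ℝ) ≤ k := by exact_mod_cast hk1
      rw [Real.sqrt_le_left (by positivity), mul_pow, Real.sq_sqrt (by positivity)]
      linarith
    rw [mul_div_assoc', div_le_iff₀ hkpos]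
    calc Y * 2 = 2 * E * √y := by linear_combination 2 * hE2
      _ ≤ 2 * E * (2 * √(k : ℝ)) := by gcongr
      _ = _ := by ring
  have hmain : (k + 1) * (3 * √Y) ≤ 6 * E := by
    rw [← hE1]
    have : (k + 1 : ℝ) ≤ 2 * y := by linarith
    calc (k + 1) * (3 * √Y) ≤ (2 * y) * (3 * √Y) := by gcongr
      _ = _ := by ring
  have hcard : (((Finset.Icc (-a : ℤ) a ×ˢ Finset.Icc (-b : ℤ) b).filter fun p =>
      |4 * (p.1 : ℝ) ^ 3 + 27 * (p.2 : ℝ) ^ 2| ≤ Y).card : ℝ) ≤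
      ∑ A ∈ Finset.Icc (-a : ℤ) a, f A.natAbs := by
    calc _ ≤ ((∑ A ∈ Finset.Icc (-a : ℤ) a, ((Finset.Icc (-b : ℤ) b).filter fun B : ℤ =>
          |4 * (A : ℝ) ^ 3 + 27 * (B : ℝ) ^ 2| ≤ Y).card : ℕ) : ℝ) := by
          exact_mod_cast (Finset.card_le_card hsub).trans (Finset.card_biUnion_le.trans
            (Finset.sum_le_sum fun A _ => Finset.card_image_le))
      _ ≤ _ := by
          push_cast
          exact Finset.sum_le_sum fun A _ => hfib A
  have := sum_Icc_neg_natAbs_le f hf0 a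
  linarith

theorem height_bounds {A B : ℤ} {X : ℝ} :
    (Eheight A B : ℝ) ≤ X ↔ 4 * |(A : ℝ)| ^ 3 ≤ X ∧ 27 * (B : ℝ) ^ 2 ≤ X := by
  rw [Eheight]; push_cast; exact max_le_iff

theorem mem_box_of_mem_FX {X : ℝ} (hX : 0 ≤ X) {p : ℤ × ℤ} (hp : p ∈ FX X) :
    p ∈ Finset.Icc (-(⌊X ^ (1 / 3 : ℝ)⌋₊ : ℤ)) ⌊X ^ (1 / 3 : ℝ)⌋₊ ×ˢ
      Finset.Icc (-(⌊X ^ (1 / 2 : ℝ)⌋₊ : ℤ)) ⌊X ^ (1 / 2 : ℝ)⌋₊ := by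
  obtain ⟨hA, hB⟩ := height_bounds.1 hp.2
  have h1 : p.1.natAbs ≤ ⌊X ^ (1 / 3 : ℝ)⌋₊ := by
    refine Nat.le_floor ?_
    rw [Nat.cast_natAbs, Int.cast_abs, one_div,
      ← Real.pow_rpow_inv_natCast (abs_nonneg (p.1 : ℝ)) three_ne_zero]
    have : 0 ≤ |(p.1 : ℝ)| ^ 3 := by positivity
    exact Real.rpow_le_rpow this (by linarith) (by norm_num)
  have h2 : p.2.natAbs ≤ ⌊X ^ (1 / 2 : ℝ)⌋₊ := by
    refine Nat.le_floor ?_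
    rw [Nat.cast_natAbs, Int.cast_abs, ← Real.sqrt_eq_rpow]
    exact Real.abs_le_sqrt (by nlinarith [sq_nonneg (p.2 : ℝ)])
  rw [Finset.mem_product, Finset.mem_Icc, Finset.mem_Icc]
  omega

theorem FX_finite (X : ℝ) : (FX X).Finite := by
  rcases lt_or_ge X 0 with hX | hX
  · convert Set.finite_empty
    refine Set.eq_empty_of_forall_notMem fun p hp => ?_
    have := (height_bounds.1 hp.2).2
    nlinarith [sq_nonneg (p.2 : ℝ)]
  · exact (Finset.finite_toSet _).subset fun p hp => mem_box_of_mem_FX hX hp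

theorem FX_eq_empty {X : ℝ} (hX : X < 4) : FX X = ∅ := by
  refine Set.eq_empty_of_forall_notMem fun p hp => ?_
  obtain ⟨hA, hB⟩ := height_bounds.1 hp.2
  have h1 : p.1 = 0 := by
    by_contra h
    have h2 : (1 : ℝ) ≤ |(p.1 : ℝ)| := by exact_mod_cast Int.one_le_abs h
    have := one_le_pow₀ h2 (n := 3)
    linarith
  have h2 : p.2 = 0 := by
    by_contra h
    have h2 : (1 : ℝ) ≤ |(p.2 : ℝ)| := by exact_mod_cast Int.one_le_abs h
    have := one_le_pow₀ h2 (n := 2)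
    rw [sq_abs] at this
    linarith
  exact hp.1.1 (by rw [h1, h2]; norm_num)

/-- Few pairs `(A, B)` in a box satisfy `k ^ 4 ∣ A` and `k ^ 6 ∣ B` for some `k ≥ 2`. -/
theorem card_nonminimal_le (a b : ℕ) :
    (((Finset.Ioc 0 a ×ˢ Finset.Ioc 0 b).filter fun p =>
      ∃ k ∈ Finset.Ioo 1 (a + 1), k ^ 4 ∣ p.1 ∧ k ^ 6 ∣ p.2).card : ℝ) ≤ a * b / 2 := by
  classical
  have hsub : ((Finset.Ioc 0 a ×ˢ Finset.Ioc 0 b).filter fun p =>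
      ∃ k ∈ Finset.Ioo 1 (a + 1), k ^ 4 ∣ p.1 ∧ k ^ 6 ∣ p.2) ⊆
      (Finset.Ioo 1 (a + 1)).biUnion fun k =>
        (Finset.Ioc 0 a).filter (k ^ 4 ∣ ·) ×ˢ (Finset.Ioc 0 b).filter (k ^ 6 ∣ ·) := by
    intro p hp
    obtain ⟨hp1, k, hk, h1, h2⟩ := Finset.mem_filter.1 hp
    rw [Finset.mem_product] at hp1
    exact Finset.mem_biUnion.2 ⟨k, hk, Finset.mem_product.2
      ⟨Finset.mem_filter.2 ⟨hp1.1, h1⟩, Finset.mem_filter.2 ⟨hp1.2, h2⟩⟩⟩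
  have h1 := (Finset.card_le_card hsub).trans Finset.card_biUnion_le
  simp_rw [Finset.card_product, Nat.Ioc_filter_dvd_card_eq_div] at h1
  calc _ ≤ ((∑ k ∈ Finset.Ioo 1 (a + 1), a / k ^ 4 * (b / k ^ 6) : ℕ) : ℝ) := by
        exact_mod_cast h1
    _ ≤ ∑ k ∈ Finset.Ioo 1 (a + 1), (a * b / 2 : ℝ) * ((k : ℝ) ^ 2)⁻¹ := by
        push_cast
        refine Finset.sum_le_sum fun k hk => ?_
        have hk2 : (2 : ℝ) ≤ k := by exact_mod_cast (Finset.mem_Ioo.1 hk).1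
        have e1 : ((a / k ^ 4 : ℕ) : ℝ) ≤ a / (k : ℝ) ^ 4 := by
          exact_mod_cast (Nat.cast_div_le (α := ℝ) (m := a) (n := k ^ 4))
        have e2 : ((b / k ^ 6 : ℕ) : ℝ) ≤ b / (k : ℝ) ^ 6 := by
          exact_mod_cast (Nat.cast_div_le (α := ℝ) (m := b) (n := k ^ 6))
        calc ((a / k ^ 4 : ℕ) : ℝ) * ((b / k ^ 6 : ℕ) : ℝ)
            ≤ (a / (k : ℝ) ^ 4) * (b / (k : ℝ) ^ 6) := by gcongr
          _ = a * b / (k : ℝ) ^ 8 * ((k : ℝ) ^ 2)⁻¹ := by field_simp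
          _ ≤ _ := by
            gcongr
            calc (2 : ℝ) ≤ 2 ^ 8 := by norm_num
              _ ≤ (k : ℝ) ^ 8 := by gcongr
    _ ≤ (a * b / 2 : ℝ) * 1 := by
        rw [← Finset.mul_sum]
        gcongr
        have := sum_Ioo_inv_sq_le (α := ℝ) 1 (a + 1)
        norm_num at this
        exact this
    _ = _ := mul_one _

theorem half_mul_le_ncard_FX {X : ℝ} {a b : ℕ} (ha : 4 * (a : ℝ) ^ 3 ≤ X)
    (hb : 27 * (b : ℝ) ^ 2 ≤ X) : (a * b / 2 : ℝ) ≤ (FX X).ncard := by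
  classical
  set bad := (Finset.Ioc 0 a ×ˢ Finset.Ioc 0 b).filter fun p =>
      ∃ k ∈ Finset.Ioo 1 (a + 1), k ^ 4 ∣ p.1 ∧ k ^ 6 ∣ p.2 with hbad
  set good := (Finset.Ioc 0 a ×ˢ Finset.Ioc 0 b).filter fun p =>
      ¬ ∃ k ∈ Finset.Ioo 1 (a + 1), k ^ 4 ∣ p.1 ∧ k ^ 6 ∣ p.2 with hgood
  have h1 : bad.card + good.card = a * b := by
    rw [hbad, hgood, Finset.card_filter_add_card_filter_not, Finset.card_product]
    simp
  have h1' : (bad.card : ℝ) + good.card = a * b := by exact_mod_cast h1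
  have h2 := card_nonminimal_le a b
  have h3 : good.card ≤ (FX X).ncard := by
    rw [← Set.ncard_coe_finset]
    refine Set.ncard_le_ncard_of_injOn (fun p : ℕ × ℕ => ((p.1 : ℤ), (p.2 : ℤ))) ?_ ?_ (FX_finite X)
    · intro p hp
      obtain ⟨hp1, hp2⟩ := Finset.mem_filter.1 (Finset.mem_coe.1 hp)
      rw [Finset.mem_product, Finset.mem_Ioc, Finset.mem_Ioc] at hp1
      obtain ⟨⟨hA0, hAa⟩, hB0, hBb⟩ := hp1
      refine ⟨⟨?_, fun q hq hdvd => hp2 ⟨q, ?_, ?_, ?_⟩⟩, height_bounds.2 ⟨?_, ?_⟩⟩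
      · dsimp only; positivity
      · have hle : q ^ 4 ≤ p.1 :=
          Nat.le_of_dvd hA0 (Int.natCast_dvd_natCast.1 (by push_cast; exact hdvd.1))
        have := Nat.le_self_pow (n := 4) (by norm_num) q
        rw [Finset.mem_Ioo]
        exact ⟨hq.one_lt, by omega⟩
      · exact Int.natCast_dvd_natCast.1 (by push_cast; exact hdvd.1)
      · exact Int.natCast_dvd_natCast.1 (by push_cast; exact hdvd.2)
      · refine le_trans ?_ ha
        dsimp only
        rw [Int.cast_natCast, Nat.abs_cast]
        gcongr
      · refine le_trans ?_ hb
        dsimp only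
        rw [Int.cast_natCast]
        gcongr
    · intro p _ q _ h
      simp only [Prod.mk.injEq, Nat.cast_inj] at h
      exact Prod.ext h.1 h.2
  have h3' : (good.card : ℝ) ≤ (FX X).ncard := by exact_mod_cast h3
  rw [← hbad] at h2
  linarith

theorem half_le_floor {x : ℝ} (hx : 1 ≤ x) : x / 2 ≤ ⌊x⌋₊ := by
  have h1 : (1 : ℝ) ≤ ⌊x⌋₊ := by exact_mod_cast Nat.le_floor (by simpa using hx)
  have h2 := Nat.lt_floor_add_one x
  linarith

theorem rpow_le_ncard_FX {X : ℝ} (hX : 4 ≤ X) : X ^ (5 / 6 : ℝ) / 96 ≤ (FX X).ncard := by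
  have hX0 : 0 < X := by linarith
  rcases lt_or_ge X 36 with h | h
  · have h1 : 0 < (FX X).ncard := by
      refine (Set.ncard_pos (FX_finite X)).2 ⟨(1, 0), ⟨by norm_num, fun p hp hdvd => ?_⟩, ?_⟩
      · have h2 := Int.eq_one_of_dvd_one (by positivity) hdvd.1
        have h3 : p ^ 4 = 1 := by exact_mod_cast h2
        exact hp.one_lt.ne' (by simpa using h3)
      · exact height_bounds.2 (by norm_num; exact ⟨hX, hX0.le⟩)
    have h2 : X ^ (5 / 6 : ℝ) ≤ X ^ (1 : ℝ) :=
      Real.rpow_le_rpow_of_exponent_le (by linarith) (by norm_num)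
    rw [Real.rpow_one] at h2
    have h3 : (1 : ℝ) ≤ (FX X).ncard := by exact_mod_cast h1
    linarith
  · set α := X ^ (1 / 3 : ℝ) with hα
    set β := √X with hβ
    have hα3 : α ^ 3 = X := by
      rw [hα, ← Real.rpow_natCast, ← Real.rpow_mul hX0.le]; norm_num
    have hβ2 : β ^ 2 = X := Real.sq_sqrt hX0.le
    have hα2 : 2 ≤ α := by
      by_contra hlt
      have : α ^ 3 < 2 ^ 3 := pow_lt_pow_left₀ (not_le.1 hlt) (by positivity) (by norm_num)
      rw [hα3] at this
      linarith
    have hβ6 : 6 ≤ β := Real.le_sqrt_of_sq_le (by linarith)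
    have ha := half_le_floor (x := α / 2) (by linarith)
    have hb := half_le_floor (x := β / 6) (by linarith)
    have ha' : (⌊α / 2⌋₊ : ℝ) ≤ α / 2 := Nat.floor_le (by linarith)
    have hb' : (⌊β / 6⌋₊ : ℝ) ≤ β / 6 := Nat.floor_le (by linarith)
    have ha3 := pow_le_pow_left₀ (by positivity) ha' 3
    have hb2 := pow_le_pow_left₀ (by positivity) hb' 2
    rw [div_pow, hα3] at ha3
    rw [div_pow, hβ2] at hb2
    refine le_trans ?_ (half_mul_le_ncard_FX (X := X) (a := ⌊α / 2⌋₊) (b := ⌊β / 6⌋₊)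
      (by linarith) (by linarith))
    have e : X ^ (5 / 6 : ℝ) = α * β := by
      rw [hα, hβ, Real.sqrt_eq_rpow, ← Real.rpow_add hX0]; norm_num
    calc X ^ (5 / 6 : ℝ) / 96 = (α / 2 / 2) * (β / 6 / 2) / 2 := by rw [e]; ring
      _ ≤ _ := by gcongr

/-- The exceptional curves are covered by four families: `A = 0`, small discriminant, medium
square part, large square part. -/
theorem ncard_FX_diff_le {δ X : ℝ} (hδ : 0 < δ) (hδ1 : δ < 1 / 6) (hX : 1 ≤ X) {K : ℕ}
    (hK : ∀ n : ℕ, n ≠ 0 → (n : ℝ) ≤ 6912 * X → n.divisors.card ≤ K) :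
    ((FX X \ Fdelta δ X).ncard : ℝ) ≤ 3 * X ^ (1 / 2 : ℝ) +
      (28 * (X ^ (1 - δ)) ^ (5 / 6 : ℝ) + 4 * X ^ (1 / 3 : ℝ)) +
      3 * X ^ (1 / 3 : ℝ) * (K * (K * (432 * X ^ (1 / 2 : ℝ) / X ^ δ + 2 * X ^ (1 / 3 : ℝ)))) +
      3 * X ^ (1 / 3 : ℝ) * (65 * X ^ (1 / 3 : ℝ)) * (5886 * K * (2 * K) * K) := by
  classical
  have hX0 : 0 < X := by linarith
  set α := X ^ (1 / 3 : ℝ) with hα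
  set β := X ^ (1 / 2 : ℝ) with hβ
  have hα1 : 1 ≤ α := Real.one_le_rpow hX (by norm_num)
  have hβ1 : 1 ≤ β := Real.one_le_rpow hX (by norm_num)
  have hα3 : α ^ 3 = X := by
    rw [hα, ← Real.rpow_natCast, ← Real.rpow_mul hX0.le]; norm_num
  have hβ2 : β ^ 2 = X := by
    rw [hβ, ← Real.rpow_natCast, ← Real.rpow_mul hX0.le]; norm_num
  set a := ⌊α⌋₊ with ha
  set b := ⌊β⌋₊ with hb
  set z := ⌊X ^ δ⌋₊ with hz
  set V := ⌊6 * β⌋₊ with hV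
  set M := ⌊32 * α⌋₊ with hM
  have haα : (a : ℝ) ≤ α := Nat.floor_le (by linarith)
  have hbβ : (b : ℝ) ≤ β := Nat.floor_le (by linarith)
  have hVβ : (V : ℝ) ≤ 6 * β := Nat.floor_le (by linarith)
  have hMα : (M : ℝ) ≤ 32 * α := Nat.floor_le (by linarith)
  have ha3 : (a : ℝ) ^ 3 ≤ X := hα3 ▸ pow_le_pow_left₀ (by positivity) haα 3
  have hαX : α ^ 2 ≤ X := by
    calc α ^ 2 ≤ α ^ 3 := pow_le_pow_right₀ hα1 (by norm_num)
      _ = X := hα3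
  have hβX : β ≤ X := by nlinarith
  set box := Finset.Icc (-a : ℤ) a ×ˢ Finset.Icc (-b : ℤ) b with hbox
  set S₀ : Finset (ℤ × ℤ) := {(0 : ℤ)} ×ˢ Finset.Icc (-b : ℤ) b with hS₀
  set S₁ := box.filter fun p => |4 * (p.1 : ℝ) ^ 3 + 27 * (p.2 : ℝ) ^ 2| ≤ X ^ (1 - δ) with hS₁
  set S₂ := box.filter fun p => p.1 ≠ 0 ∧
      ∃ l ∈ Finset.Ioc z a, ((l ^ 2 : ℕ) : ℤ) ∣ discAB p.1 p.2 with hS₂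
  set S₃ := box.filter fun p => p.1 ≠ 0 ∧
      ∃ m l : ℤ, Squarefree m ∧ |m| ≤ M ∧ 0 < l ∧ l ≤ V ∧ discAB p.1 p.2 = m * l ^ 2 with hS₃
  have hcover : FX X \ Fdelta δ X ⊆ ((S₀ ∪ S₁ ∪ S₂ ∪ S₃ : Finset (ℤ × ℤ)) : Set (ℤ × ℤ)) := by
    rintro p ⟨hp, hpδ⟩
    have hpbox : p ∈ box := mem_box_of_mem_FX hX0.le hp
    obtain ⟨hA, hB⟩ := height_bounds.1 hp.2
    simp only [Finset.coe_union, Set.mem_union, Finset.mem_coe]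
    have hdisc : (discAB p.1 p.2 : ℝ) = -16 * (4 * (p.1 : ℝ) ^ 3 + 27 * (p.2 : ℝ) ^ 2) := by
      rw [discAB]; push_cast; ring
    have hdisc_abs : |(discAB p.1 p.2 : ℝ)| = 16 * |4 * (p.1 : ℝ) ^ 3 + 27 * (p.2 : ℝ) ^ 2| := by
      rw [hdisc, abs_mul]; norm_num
    by_cases hsmall : |4 * (p.1 : ℝ) ^ 3 + 27 * (p.2 : ℝ) ^ 2| ≤ X ^ (1 - δ)
    · exact Or.inl (Or.inl (Or.inr (Finset.mem_filter.2 ⟨hpbox, hsmall⟩)))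
    by_cases hA0 : p.1 = 0
    · exact Or.inl (Or.inl (Or.inl (Finset.mem_product.2
        ⟨Finset.mem_singleton.2 hA0, (Finset.mem_product.1 hpbox).2⟩)))
    have hXδ : 0 < X ^ δ := by positivity
    have hsq : X ^ δ < (sqPart (discAB p.1 p.2) : ℝ) := by
      by_contra hle
      refine hpδ ⟨hp, ?_, by linarith⟩
      rw [hdisc_abs]
      have := abs_nonneg (4 * (p.1 : ℝ) ^ 3 + 27 * (p.2 : ℝ) ^ 2)
      linarith
    have hne : discAB p.1 p.2 ≠ 0 := mul_ne_zero (by norm_num) hp.1.1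
    obtain ⟨m, hm, hml⟩ := exists_squarefree_mul_sqPart_sq hne
    set l := sqPart (discAB p.1 p.2) with hl
    have hzl : z < l := (Nat.floor_lt hXδ.le).2 hsq
    by_cases hla : l ≤ a
    · refine Or.inl (Or.inr (Finset.mem_filter.2 ⟨hpbox, hA0, l, Finset.mem_Ioc.2 ⟨hzl, hla⟩, ?_⟩))
      rw [hml]; push_cast
      exact dvd_mul_left _ _
    · refine Or.inr (Finset.mem_filter.2 ⟨hpbox, hA0, m, l, hm, ?_, ?_, ?_, hml⟩)
      all_goals
        have hαl : α < l := (Nat.floor_lt (by linarith)).1 (not_le.1 hla)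
        have hl0 : (0 : ℝ) < l := by linarith
        have h32 : |(m : ℝ)| * (l : ℝ) ^ 2 ≤ 32 * X := by
          have e : (discAB p.1 p.2 : ℝ) = m * (l : ℝ) ^ 2 := by exact_mod_cast hml
          rw [← abs_of_pos (pow_pos hl0 2), ← abs_mul, ← e, hdisc_abs]
          have h1 : |4 * (p.1 : ℝ) ^ 3 + 27 * (p.2 : ℝ) ^ 2| ≤ 2 * X := by
            rw [← abs_pow] at hA
            have h2 := le_abs_self ((p.1 : ℝ) ^ 3)
            have h3 := neg_abs_le ((p.1 : ℝ) ^ 3)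
            have h4 := sq_nonneg (p.2 : ℝ)
            rw [abs_le]
            constructor <;> linarith
          linarith
      · have : m.natAbs ≤ M := by
          refine Nat.le_floor ?_
          rw [Nat.cast_natAbs, Int.cast_abs]
          have h1 : |(m : ℝ)| * α ^ 2 ≤ 32 * α * α ^ 2 := by
            calc |(m : ℝ)| * α ^ 2 ≤ |(m : ℝ)| * (l : ℝ) ^ 2 := by gcongr
              _ ≤ 32 * X := h32
              _ = 32 * α * α ^ 2 := by rw [← hα3]; ring
          exact le_of_mul_le_mul_right h1 (by positivity)
        rw [Int.abs_eq_natAbs]; exact_mod_cast this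
      · exact_mod_cast hl0
      · have : l ≤ V := by
          refine Nat.le_floor (le_of_sq_le_sq ?_ (by linarith))
          have h1 : (1 : ℝ) ≤ |(m : ℝ)| := by exact_mod_cast Int.one_le_abs hm.ne_zero
          have h2 : 1 * (l : ℝ) ^ 2 ≤ |(m : ℝ)| * (l : ℝ) ^ 2 := by gcongr
          rw [mul_pow, hβ2]
          linarith
        exact_mod_cast this
  have h₀ : (S₀.card : ℝ) ≤ 3 * β := by
    have h1 : S₀.card = 2 * b + 1 := by
      rw [hS₀, Finset.card_product, Finset.card_singleton, Int.card_Icc]; omega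
    rw [h1]; push_cast; linarith
  have h₁ : (S₁.card : ℝ) ≤ 28 * (X ^ (1 - δ)) ^ (5 / 6 : ℝ) + 4 * α := by
    have := card_small_disc_le (Y := X ^ (1 - δ)) (Real.one_le_rpow hX (by linarith)) a b
    refine le_trans (le_of_eq ?_) (this.trans (by linarith))
    congr!
  have h₂ : (S₂.card : ℝ) ≤ 3 * α * (K * (K * (432 * β / X ^ δ + 2 * α))) := by
    have hzX : X ^ δ ≤ z + 1 := (Nat.lt_floor_add_one _).le
    have := card_medium_sqPart_le a b z a K (fun n hn hna => hK n hn ?_) (fun l hl => hK _ ?_ ?_)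
    · refine le_trans (le_of_eq ?_) (this.trans ?_)
      · congr!
      · gcongr
        linarith
    · have : (n : ℝ) ≤ 6912 * (a : ℝ) ^ 3 := by exact_mod_cast hna
      linarith
    · have := (Finset.mem_Ioc.1 hl).1
      exact pow_ne_zero 2 (by omega)
    · have h1 : (l : ℝ) ≤ α := le_trans (by exact_mod_cast (Finset.mem_Ioc.1 hl).2) haα
      have h2 := pow_le_pow_left₀ (by positivity) h1 2
      push_cast
      linarith
  have h₃ : (S₃.card : ℝ) ≤ 3 * α * (65 * α) * (5886 * K * (2 * K) * K) := by
    have hlog : Nat.log 2 V + 1 ≤ K := by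
      have h1 : V ≠ 0 := by
        have : 1 ≤ V := Nat.le_floor (by push_cast; linarith)
        omega
      have h2 := hK (2 ^ Nat.log 2 V) (by positivity) ?_
      · rwa [Nat.divisors_prime_pow Nat.prime_two, Finset.card_map, Finset.card_range] at h2
      · have : ((2 ^ Nat.log 2 V : ℕ) : ℝ) ≤ V := by exact_mod_cast Nat.pow_log_le_self 2 h1
        linarith
    have := card_large_sqPart_le a b V M K (fun n hn hna => hK n hn ?_)
    · calc (S₃.card : ℝ) ≤ (((2 * a + 1) * (2 * M + 1) *
            (5886 * K * (2 * (Nat.log 2 V + 1)) * K) : ℕ) : ℝ) := by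
            refine le_trans (le_of_eq ?_) (Nat.cast_le.2 this)
            congr!
        _ ≤ (((2 * a + 1) * (2 * M + 1) * (5886 * K * (2 * K) * K) : ℕ) : ℝ) := by
            gcongr
        _ ≤ _ := by
            push_cast
            gcongr
            · linarith
            · linarith
    · have : (n : ℝ) ≤ 1728 * (a : ℝ) ^ 3 := by exact_mod_cast hna
      linarith
  have hncard := Set.ncard_le_ncard hcover (Finset.finite_toSet _)
  rw [Set.ncard_coe_finset] at hncard
  have hc : (S₀ ∪ S₁ ∪ S₂ ∪ S₃).card ≤ S₀.card + S₁.card + S₂.card + S₃.card :=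
    (Finset.card_union_le _ _).trans (Nat.add_le_add_right
      ((Finset.card_union_le _ _).trans (Nat.add_le_add_right (Finset.card_union_le _ _) _)) _)
  have hfin : ((FX X \ Fdelta δ X).ncard : ℝ) ≤ S₀.card + S₁.card + S₂.card + S₃.card := by
    exact_mod_cast hncard.trans hc
  linarith

theorem exists_ncard_FX_diff_le {δ : ℝ} (hδ : 0 < δ) (hδ1 : δ < 1 / 6) :
    ∃ C : ℝ, 0 < C ∧ ∀ X : ℝ, 1 ≤ X →
      ((FX X \ Fdelta δ X).ncard : ℝ) ≤ C * X ^ (5 / 6 - 5 * δ / 6) := by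
  obtain ⟨c, hc1, hc⟩ := exists_card_divisors_le_rpow (ε := δ / 18) (by linarith)
  set D := c * (6912 : ℝ) ^ (δ / 18) with hD
  have hD0 : 0 < D := by positivity
  refine ⟨3 + (28 + 4) + 3 * D ^ 2 * (432 + 2) + 3 * 65 * 5886 * 2 * D ^ 3, by positivity,
    fun X hX => ?_⟩
  have hX0 : 0 < X := by linarith
  set E := X ^ (5 / 6 - 5 * δ / 6) with hE
  set κ := D * X ^ (δ / 18) with hκ
  have hκ0 : 0 ≤ κ := by positivity
  have hKκ : (⌊κ⌋₊ : ℝ) ≤ κ := Nat.floor_le hκ0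
  have hpow : ∀ t : ℝ, t ≤ 5 / 6 - 5 * δ / 6 → X ^ t ≤ E := fun t ht =>
    Real.rpow_le_rpow_of_exponent_le hX ht
  have e1 := hpow (1 / 2) (by linarith)
  have e2 := hpow (1 / 3) (by linarith)
  have e3 : (X ^ (1 - δ)) ^ (5 / 6 : ℝ) ≤ E := by
    rw [← Real.rpow_mul hX0.le]; exact hpow _ (by linarith)
  have e4 : X ^ (1 / 3 : ℝ) * X ^ (1 / 2 : ℝ) / X ^ δ * (X ^ (δ / 18)) ^ 2 ≤ E := by
    rw [← Real.rpow_natCast, ← Real.rpow_mul hX0.le, ← Real.rpow_add hX0, ← Real.rpow_sub hX0,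
      ← Real.rpow_add hX0]
    exact hpow _ (by push_cast; linarith)
  have e5 : X ^ (1 / 3 : ℝ) * X ^ (1 / 3 : ℝ) * (X ^ (δ / 18)) ^ 2 ≤ E := by
    rw [← Real.rpow_natCast, ← Real.rpow_mul hX0.le, ← Real.rpow_add hX0, ← Real.rpow_add hX0]
    exact hpow _ (by push_cast; linarith)
  have e6 : X ^ (1 / 3 : ℝ) * X ^ (1 / 3 : ℝ) * (X ^ (δ / 18)) ^ 3 ≤ E := by
    rw [← Real.rpow_natCast, ← Real.rpow_mul hX0.le, ← Real.rpow_add hX0, ← Real.rpow_add hX0]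
    exact hpow _ (by push_cast; linarith)
  have hmain := ncard_FX_diff_le hδ hδ1 hX (K := ⌊κ⌋₊) fun n hn hnX => Nat.le_floor ?_
  · refine hmain.trans ?_
    calc _ ≤ 3 * X ^ (1 / 2 : ℝ) +
          (28 * (X ^ (1 - δ)) ^ (5 / 6 : ℝ) + 4 * X ^ (1 / 3 : ℝ)) +
          3 * X ^ (1 / 3 : ℝ) * (κ * (κ * (432 * X ^ (1 / 2 : ℝ) / X ^ δ + 2 * X ^ (1 / 3 : ℝ)))) +
          3 * X ^ (1 / 3 : ℝ) * (65 * X ^ (1 / 3 : ℝ)) * (5886 * κ * (2 * κ) * κ) := by gcongr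
      _ = 3 * X ^ (1 / 2 : ℝ) +
          (28 * (X ^ (1 - δ)) ^ (5 / 6 : ℝ) + 4 * X ^ (1 / 3 : ℝ)) +
          3 * D ^ 2 * (432 * (X ^ (1 / 3 : ℝ) * X ^ (1 / 2 : ℝ) / X ^ δ * (X ^ (δ / 18)) ^ 2) +
            2 * (X ^ (1 / 3 : ℝ) * X ^ (1 / 3 : ℝ) * (X ^ (δ / 18)) ^ 2)) +
          3 * 65 * 5886 * 2 * D ^ 3 *
            (X ^ (1 / 3 : ℝ) * X ^ (1 / 3 : ℝ) * (X ^ (δ / 18)) ^ 3) := by rw [hκ]; ring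
      _ ≤ 3 * E + (28 * E + 4 * E) + 3 * D ^ 2 * (432 * E + 2 * E) +
          3 * 65 * 5886 * 2 * D ^ 3 * E := by gcongr
      _ = _ := by ring
  · calc (n.divisors.card : ℝ) ≤ c * (n : ℝ) ^ (δ / 18) := hc n hn
      _ ≤ c * (6912 * X) ^ (δ / 18) := by gcongr
      _ = κ := by rw [Real.mul_rpow (by norm_num) hX0.le, hκ, hD]; ring

/-- `#𝓕_δ(X) = #𝓕(X) (1 + O(X^{-5δ/6}))` for fixed `δ ∈ (0, 1/6)`. -/
theorem Fdelta_card (δ : ℝ) (hδ : δ ∈ Set.Ioo (0 : ℝ) (1 / 6)) :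
    ∃ C : ℝ, 0 < C ∧ ∀ X : ℝ, 1 ≤ X →
      |(Nat.card {p : ℤ × ℤ // p ∈ FX X} : ℝ) - (Nat.card {p : ℤ × ℤ // p ∈ Fdelta δ X} : ℝ)| ≤
        C * (Nat.card {p : ℤ × ℤ // p ∈ FX X} : ℝ) * X ^ (-(5 * δ) / 6) := by
  obtain ⟨C, hC, hdiff⟩ := exists_ncard_FX_diff_le hδ.1 hδ.2
  refine ⟨96 * C, by positivity, fun X hX => ?_⟩
  have hsub : Fdelta δ X ⊆ FX X := fun p hp => hp.1
  change |((FX X).ncard : ℝ) - ((Fdelta δ X).ncard : ℝ)| ≤ 96 * C * ((FX X).ncard : ℝ) * _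
  have hsplit := Set.ncard_sdiff_add_ncard_of_subset hsub (FX_finite X)
  have hsplit' : ((FX X \ Fdelta δ X).ncard : ℝ) + (Fdelta δ X).ncard = (FX X).ncard := by
    exact_mod_cast hsplit
  rw [← hsplit', add_sub_cancel_right, abs_of_nonneg (by positivity), hsplit']
  rcases lt_or_ge X 4 with h4 | h4
  · simp [FX_eq_empty h4]
  have hX0 : 0 < X := by linarith
  calc ((FX X \ Fdelta δ X).ncard : ℝ) ≤ C * X ^ (5 / 6 - 5 * δ / 6) := hdiff X hX
    _ = 96 * C * (X ^ (5 / 6 : ℝ) / 96) * X ^ (-(5 * δ) / 6) := by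
        rw [show (5 / 6 - 5 * δ / 6 : ℝ) = 5 / 6 + -(5 * δ) / 6 by ring, Real.rpow_add hX0]
        ring
    _ ≤ 96 * C * ((FX X).ncard : ℝ) * X ^ (-(5 * δ) / 6) := by
        gcongr
        exact rpow_le_ncard_FX h4
end

section
/- Let δ ∈ (0, 1/6) be fixed. Then #{E_{A,B} ∈ 𝓕(X) : |Δ(E_{A,B})| ≤ X^{1−δ}} ≪ X^{5/6 − 5δ/6}, with implied constant depending only on δ. -/
open Finset in
theorem Finset.card_le_of_forall_sub_le (S : Finset ℕ) (D : ℝ) (hD : 0 ≤ D)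
    (h : ∀ a ∈ S, ∀ b ∈ S, (b : ℝ) - a ≤ D) : (#S : ℝ) ≤ 1 + D := by
  rcases S.eq_empty_or_nonempty with rfl | hS
  · simp only [card_empty, Nat.cast_zero]
    linarith
  · have hsub : S ⊆ Icc (S.min' hS) (S.max' hS) := fun x hx =>
      mem_Icc.2 ⟨S.min'_le x hx, S.le_max' x hx⟩
    have hle := card_le_card hsub
    rw [Nat.card_Icc] at hle
    have hD' := h _ (S.min'_mem hS) _ (S.max'_mem hS)
    have hmm : S.min' hS ≤ S.max' hS := S.min'_le _ (S.max'_mem hS)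
    have hle' : #S + S.min' hS ≤ S.max' hS + 1 := by omega
    have : (#S : ℝ) + (S.min' hS : ℕ) ≤ (S.max' hS : ℕ) + 1 := by exact_mod_cast hle'
    linarith

/-- If `27 b² - 4 a³` and `27 c² - 4 a³` are both at most `u⁶ / 16` in absolute value, then this
bounds `c - b`, where `k` is a threshold close to `u²`. -/
noncomputable def gapBound (u : ℝ) (k a : ℕ) : ℝ :=
  if a ≤ k then u ^ 3 else 3 * u ^ 6 / √a ^ 3

theorem gapBound_nonneg {u : ℝ} (hu : 0 ≤ u) (k a : ℕ) : 0 ≤ gapBound u k a := by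
  unfold gapBound
  split_ifs <;> positivity

theorem sub_le_gapBound {u : ℝ} (hu : 1 ≤ u) {k : ℕ} (hk : u ^ 2 ≤ k + 1) {a b c : ℕ}
    (hb : |27 * (b : ℝ) ^ 2 - 4 * (a : ℝ) ^ 3| ≤ u ^ 6 / 16)
    (hc : |27 * (c : ℝ) ^ 2 - 4 * (a : ℝ) ^ 3| ≤ u ^ 6 / 16) :
    (c : ℝ) - b ≤ gapBound u k a := by
  rw [abs_le] at hb hc
  have hb0 : (0 : ℝ) ≤ b := b.cast_nonneg
  have hc0 : (0 : ℝ) ≤ c := c.cast_nonneg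
  have hu6 : 0 < u ^ 6 := by positivity
  have hdiff : ((c : ℝ) - b) * (c + b) ≤ u ^ 6 := by nlinarith
  rcases le_total (c : ℝ) b with h | h
  · linarith [gapBound_nonneg (by linarith : 0 ≤ u) k a]
  unfold gapBound
  split_ifs with hak
  · refine (sq_le_sq₀ (by linarith) (by positivity)).1 ?_
    nlinarith
  · have hka : ((k : ℝ) + 1) ≤ a := by exact_mod_cast (not_le.1 hak)
    have ha0 : (0 : ℝ) < a := by nlinarith
    have ha3 : u ^ 6 ≤ (a : ℝ) ^ 3 := by
      calc u ^ 6 = (u ^ 2) ^ 3 := by ring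
        _ ≤ (a : ℝ) ^ 3 := by gcongr; linarith
    have hr : 0 < √(a : ℝ) := Real.sqrt_pos.2 ha0
    have hr6 : (√(a : ℝ) ^ 3) ^ 2 = (a : ℝ) ^ 3 := by
      rw [← pow_mul, mul_comm, pow_mul, Real.sq_sqrt ha0.le]
    have hcr : √(a : ℝ) ^ 3 ≤ 3 * c := by
      refine (sq_le_sq₀ (by positivity) (by positivity)).1 ?_
      nlinarith
    rw [le_div_iff₀ (by positivity)]
    nlinarith

theorem one_div_sqrt_succ_pow_three_le {x : ℝ} (hx : 0 < x) :
    1 / √(x + 1) ^ 3 ≤ 2 * (1 / √x - 1 / √(x + 1)) := by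
  have hs : 0 < √x := Real.sqrt_pos.2 hx
  have ht : 0 < √(x + 1) := Real.sqrt_pos.2 (by linarith)
  have hst : √x ≤ √(x + 1) := Real.sqrt_le_sqrt (by linarith)
  have hs2 : √x ^ 2 = x := Real.sq_sqrt hx.le
  have ht2 : √(x + 1) ^ 2 = x + 1 := Real.sq_sqrt (by linarith)
  generalize √x = s at *
  generalize √(x + 1) = t at *
  have h1 : (t - s) * (t + s) = 1 := by nlinarith
  have h2 : 1 / s - 1 / t = 1 / (s * t * (t + s)) := by
    field_simp
    linarith
  rw [h2, mul_one_div, div_le_div_iff₀ (by positivity) (by positivity)]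
  nlinarith [mul_le_mul hst hst hs.le ht.le, mul_pos hs ht]

theorem sum_range_gapBound_le_of_add {u : ℝ} {k : ℕ} (hk : 0 < k) (m : ℕ) :
    ∑ a ∈ Finset.range (k + 1 + m), gapBound u k a ≤
      (k + 1) * u ^ 3 + 6 * u ^ 6 * (1 / √k - 1 / √(k + m)) := by
  induction m with
  | zero =>
    rw [Finset.sum_congr rfl (g := fun _ => u ^ 3)]
    · simp
    · intro a ha
      exact if_pos (by simpa [Nat.lt_succ_iff] using ha)
  | succ m ih =>
    rw [← add_assoc, Finset.sum_range_succ]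
    have hlast : gapBound u k (k + 1 + m) = 3 * u ^ 6 * (1 / √((k + m : ℝ) + 1) ^ 3) := by
      unfold gapBound
      rw [if_neg (by omega), mul_one_div]
      push_cast
      rw [add_right_comm]
    have hstep := mul_le_mul_of_nonneg_left
      (one_div_sqrt_succ_pow_three_le (x := (k + m : ℝ)) (by positivity))
      (by positivity : 0 ≤ 3 * u ^ 6)
    rw [hlast]
    push_cast
    rw [← add_assoc]
    linarith

theorem sum_range_gapBound_le {u : ℝ} (hu : 1 ≤ u) (n : ℕ) :
    ∑ a ∈ Finset.range n, gapBound u ⌊u ^ 2⌋₊ a ≤ 14 * u ^ 5 := by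
  have hu2 : 1 ≤ u ^ 2 := one_le_pow₀ hu
  set k := ⌊u ^ 2⌋₊ with hk_def
  have hk : 0 < k := Nat.floor_pos.2 hu2
  have hk1 : (1 : ℝ) ≤ k := by exact_mod_cast hk
  have hku : (k : ℝ) ≤ u ^ 2 := Nat.floor_le (by positivity)
  have huk : u ^ 2 < k + 1 := Nat.lt_floor_add_one _
  have hroot : u / 2 ≤ √(k : ℝ) := by
    refine Real.le_sqrt_of_sq_le ?_
    nlinarith
  have hinv : 1 / √(k : ℝ) ≤ 2 / u := by
    rw [div_le_div_iff₀ (by linarith) (by linarith)]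
    linarith
  have hpos : 0 ≤ 1 / √((k : ℝ) + n) := by positivity
  calc ∑ a ∈ Finset.range n, gapBound u k a
      ≤ ∑ a ∈ Finset.range (k + 1 + n), gapBound u k a :=
        Finset.sum_le_sum_of_subset_of_nonneg (Finset.range_mono (by omega))
          fun a _ _ => gapBound_nonneg (by linarith) k a
    _ ≤ (k + 1) * u ^ 3 + 6 * u ^ 6 * (1 / √k - 1 / √(k + n)) :=
        sum_range_gapBound_le_of_add hk n
    _ ≤ (2 * u ^ 2) * u ^ 3 + 6 * u ^ 6 * (2 / u) := by
        gcongr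
        · linarith
        · linarith
    _ = 14 * u ^ 5 := by
        field_simp
        ring

/-- The pairs `(a, b)` of natural numbers with `a ≤ N` and `b ≤ M` for which `27 b² - 4 a³` is
small. -/
noncomputable def nearCuspPairs (u : ℝ) (N M : ℕ) : Finset (Σ _ : ℕ, ℕ) :=
  (Finset.range (N + 1)).sigma fun a => (Finset.range (M + 1)).filter fun b =>
    |27 * (b : ℝ) ^ 2 - 4 * (a : ℝ) ^ 3| ≤ u ^ 6 / 16

theorem card_nearCuspPairs_le {u : ℝ} (hu : 1 ≤ u) (N M : ℕ) :
    ((nearCuspPairs u N M).card : ℝ) ≤ N + 1 + 14 * u ^ 5 := by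
  rw [nearCuspPairs, Finset.card_sigma, Nat.cast_sum]
  refine (Finset.sum_le_sum fun a _ => Finset.card_le_of_forall_sub_le _
    (gapBound u ⌊u ^ 2⌋₊ a) (gapBound_nonneg (by linarith) _ a) ?_).trans ?_
  · intro b hb c hc
    exact sub_le_gapBound hu (Nat.lt_floor_add_one _).le
      (Finset.mem_filter.1 hb).2 (Finset.mem_filter.1 hc).2
  · rw [Finset.sum_add_distrib]
    have := sum_range_gapBound_le hu (N + 1)
    simp only [Finset.sum_const, Finset.card_range, nsmul_eq_mul, mul_one]
    push_cast
    linarith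

theorem abs_sub_natAbs_le (A B : ℤ) :
    |27 * (B.natAbs : ℝ) ^ 2 - 4 * (A.natAbs : ℝ) ^ 3| ≤ |4 * (A : ℝ) ^ 3 + 27 * (B : ℝ) ^ 2| := by
  have hA : (A.natAbs : ℝ) = |(A : ℝ)| := by simp [Nat.cast_natAbs]
  have hB : (B.natAbs : ℝ) = |(B : ℝ)| := by simp [Nat.cast_natAbs]
  rw [hA, hB, sq_abs]
  rcases le_total 0 (A : ℝ) with h | h
  · have h3 : 0 ≤ (A : ℝ) ^ 3 := by positivity
    rw [abs_of_nonneg h, abs_of_nonneg (a := 4 * (A : ℝ) ^ 3 + 27 * (B : ℝ) ^ 2) (by positivity),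
      abs_le]
    constructor <;> nlinarith [sq_nonneg (B : ℝ)]
  · rw [abs_of_nonpos h]
    exact le_of_eq (congrArg _ (by ring))

/-- The four sign changes of a pair of natural numbers. -/
def signedPair (q : (Σ _ : ℕ, ℕ) × (ℤ × ℤ)) : ℤ × ℤ := (q.2.1 * q.1.1, q.2.2 * q.1.2)

theorem card_small_disc_le_s3 {X u : ℝ} (hX : 1 ≤ X) (hu : 1 ≤ u) :
    (Nat.card {p : ℤ × ℤ // p ∈ FX X ∧ |(discAB p.1 p.2 : ℝ)| ≤ u ^ 6} : ℝ) ≤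
      4 * (X ^ (1 / 3 : ℝ) + 1 + 14 * u ^ 5) := by
  set N := ⌊X ^ (1 / 3 : ℝ)⌋₊
  set M := ⌊X⌋₊
  set S : Finset (ℤ × ℤ) :=
    (nearCuspPairs u N M ×ˢ (({1, -1} : Finset ℤ) ×ˢ ({1, -1} : Finset ℤ))).image signedPair
  have hmem : {p : ℤ × ℤ | p ∈ FX X ∧ |(discAB p.1 p.2 : ℝ)| ≤ u ^ 6} ⊆ S := by
    rintro ⟨A, B⟩ ⟨⟨-, hH⟩, hdisc⟩
    have hsign : ∀ n : ℤ, ∃ s ∈ ({1, -1} : Finset ℤ), s * (n.natAbs : ℤ) = n := by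
      intro n
      rcases Int.natAbs_eq n with h | h
      · exact ⟨1, by simp, by omega⟩
      · exact ⟨-1, by simp, by omega⟩
    obtain ⟨s, hs, hsA⟩ := hsign A
    obtain ⟨t, ht, htB⟩ := hsign B
    simp only [Eheight, Int.cast_max, max_le_iff] at hH
    push_cast at hH
    have hA : (A.natAbs : ℝ) = |(A : ℝ)| := by simp [Nat.cast_natAbs]
    have hB : ((B.natAbs : ℝ)) ^ 2 = (B : ℝ) ^ 2 := by simp [Nat.cast_natAbs]
    have hAN : A.natAbs ≤ N := by
      refine Nat.le_floor ?_
      rw [hA, one_div, Real.le_rpow_inv_iff_of_pos (abs_nonneg _) (by linarith) (by norm_num)]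
      norm_cast
      push_cast
      nlinarith [pow_nonneg (abs_nonneg (A : ℝ)) 3]
    have hBM : B.natAbs ≤ M := by
      refine Nat.le_floor ?_
      have h1 : (B.natAbs : ℝ) ≤ (B.natAbs : ℝ) ^ 2 := by
        exact_mod_cast Nat.le_self_pow two_ne_zero _
      nlinarith [sq_nonneg (B : ℝ)]
    have hsmall : |27 * (B.natAbs : ℝ) ^ 2 - 4 * (A.natAbs : ℝ) ^ 3| ≤ u ^ 6 / 16 := by
      refine (abs_sub_natAbs_le A B).trans ?_
      simp only [discAB] at hdisc
      push_cast at hdisc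
      rw [abs_mul] at hdisc
      norm_num at hdisc
      linarith
    refine Finset.mem_coe.2 (Finset.mem_image.2 ⟨(⟨A.natAbs, B.natAbs⟩, (s, t)), ?_, ?_⟩)
    · simp only [Finset.mem_product, nearCuspPairs, Finset.mem_sigma, Finset.mem_filter,
        Finset.mem_range]
      exact ⟨⟨by omega, by omega, hsmall⟩, hs, ht⟩
    · exact Prod.ext hsA htB
  have hcard : Nat.card {p : ℤ × ℤ // p ∈ FX X ∧ |(discAB p.1 p.2 : ℝ)| ≤ u ^ 6} ≤
      (nearCuspPairs u N M).card * 4 := by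
    calc _ ≤ (S : Set (ℤ × ℤ)).ncard := Set.ncard_le_ncard hmem S.finite_toSet
      _ = S.card := Set.ncard_coe_finset S
      _ ≤ _ := Finset.card_image_le
      _ = _ := by rw [Finset.card_product]; rfl
  have hN : (N : ℝ) ≤ X ^ (1 / 3 : ℝ) := Nat.floor_le (by positivity)
  have hP := card_nearCuspPairs_le hu N M
  calc _ ≤ ((nearCuspPairs u N M).card : ℝ) * 4 := by exact_mod_cast hcard
    _ ≤ _ := by linarith

/-- `#{E_{A,B} ∈ 𝓕(X) : |Δ(E_{A,B})| ≤ X^{1-δ}} ≪ X^{5/6 - 5δ/6}` for fixed `δ ∈ (0, 1/6)`. -/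
theorem small_discriminant_count (δ : ℝ) (hδ : δ ∈ Set.Ioo (0 : ℝ) (1 / 6)) :
    ∃ C : ℝ, 0 < C ∧ ∀ X : ℝ, 1 ≤ X →
      (Nat.card {p : ℤ × ℤ // p ∈ FX X ∧ |(discAB p.1 p.2 : ℝ)| ≤ X ^ (1 - δ)} : ℝ) ≤
        C * X ^ (5 / 6 - 5 * δ / 6) := by
  obtain ⟨hδ0, hδ1⟩ := hδ
  refine ⟨64, by norm_num, fun X hX => ?_⟩
  have hX0 : 0 ≤ X := by linarith
  have hu : 1 ≤ X ^ ((1 - δ) / 6) := Real.one_le_rpow hX (by linarith)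
  have h6 : (X ^ ((1 - δ) / 6)) ^ 6 = X ^ (1 - δ) := by
    rw [← Real.rpow_mul_natCast hX0]
    congr 1
    push_cast
    ring
  have h5 : (X ^ ((1 - δ) / 6)) ^ 5 = X ^ (5 / 6 - 5 * δ / 6) := by
    rw [← Real.rpow_mul_natCast hX0]
    congr 1
    push_cast
    ring
  have hmain := card_small_disc_le_s3 hX hu
  rw [h6, h5] at hmain
  have h13 : X ^ (1 / 3 : ℝ) ≤ X ^ (5 / 6 - 5 * δ / 6) :=
    Real.rpow_le_rpow_of_exponent_le hX (by linarith)
  have h1 : 1 ≤ X ^ (5 / 6 - 5 * δ / 6) := Real.one_le_rpow hX (by linarith)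
  linarith
end

section
/- Let δ ∈ (0, 1/6) be fixed. Then #{(A,B) ∈ ℤ² : |A| ≤ X^{1/3} and |4A³ + 27B²| ≤ X^{1−δ}} ≪ X^{5/6 − 5δ/6}, with implied constant depending only on δ. -/
open Finset in
/-- The integers in a real interval, as a finite set, number at most its length plus one. -/
theorem card_Icc_ceil_floor_le {u v : ℝ} (h : u ≤ v) :
    ((Icc ⌈u⌉ ⌊v⌋).card : ℝ) ≤ v - u + 1 := by
  have h1 : (⌊v⌋ : ℝ) ≤ v := Int.floor_le v
  have h2 : u ≤ (⌈u⌉ : ℝ) := Int.le_ceil u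
  rw [Int.card_Icc]
  have h3 : (((⌊v⌋ + 1 - ⌈u⌉).toNat : ℤ) : ℝ) ≤ v - u + 1 := by
    rw [Int.toNat_eq_max]
    push_cast
    exact max_le (by linarith) (by linarith)
  exact_mod_cast h3

/-- For `n > t²`, the integers `B` with `|27B² - 4n³| ≤ t⁶` lie in two short intervals. -/
theorem exists_finset_of_sq_lt {t : ℝ} (ht : 1 ≤ t) {n : ℕ} (hn : t ^ 2 < n) :
    ∃ F : Finset ℤ, (F.card : ℝ) ≤ 2 + 2 * t ^ 6 / (n * √n) ∧
      ∀ B : ℤ, |27 * (B : ℝ) ^ 2 - 4 * (n : ℝ) ^ 3| ≤ t ^ 6 → B ∈ F := by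
  have hn0 : (0 : ℝ) < n := by nlinarith
  have hn3 : t ^ 6 ≤ (n : ℝ) ^ 3 := by
    calc t ^ 6 = (t ^ 2) ^ 3 := by ring
      _ ≤ _ := by gcongr
  have ht6 : 0 < t ^ 6 := by positivity
  set u := √((4 * (n : ℝ) ^ 3 - t ^ 6) / 27) with hu
  set v := √((4 * (n : ℝ) ^ 3 + t ^ 6) / 27) with hv
  have hu0 : 0 ≤ u := Real.sqrt_nonneg _
  have hu2 : u ^ 2 = (4 * (n : ℝ) ^ 3 - t ^ 6) / 27 := Real.sq_sqrt (by linarith)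
  have hv2 : v ^ 2 = (4 * (n : ℝ) ^ 3 + t ^ 6) / 27 := Real.sq_sqrt (by linarith)
  have huv : u ≤ v := Real.sqrt_le_sqrt (by linarith)
  have hs : √(n : ℝ) ^ 2 = n := Real.sq_sqrt hn0.le
  have hs0 : 0 < √(n : ℝ) := Real.sqrt_pos.2 hn0
  have hvn : n * √n / 3 ≤ v := by
    apply Real.le_sqrt_of_sq_le
    rw [div_pow, mul_pow, hs]
    linarith
  have hlen : v - u ≤ t ^ 6 / (n * √n) := by
    rw [le_div_iff₀ (by positivity)]
    nlinarith [mul_nonneg (sub_nonneg.2 huv) (sub_nonneg.2 hvn), mul_nonneg (sub_nonneg.2 huv) hu0]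
  refine ⟨Finset.Icc ⌈u⌉ ⌊v⌋ ∪ Finset.Icc ⌈-v⌉ ⌊-u⌋, ?_, fun B hB => ?_⟩
  · have h1 := card_Icc_ceil_floor_le huv
    have h2 := card_Icc_ceil_floor_le (neg_le_neg huv)
    have h3 : ((Finset.Icc ⌈u⌉ ⌊v⌋ ∪ Finset.Icc ⌈-v⌉ ⌊-u⌋).card : ℝ) ≤
        (Finset.Icc ⌈u⌉ ⌊v⌋).card + (Finset.Icc ⌈-v⌉ ⌊-u⌋).card := by
      exact_mod_cast Finset.card_union_le _ _
    rw [mul_div_assoc]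
    linarith
  · obtain ⟨hl, hr⟩ := abs_le.1 hB
    have h1 : u ≤ |(B : ℝ)| := abs_le_of_sq_le_sq' (by rw [sq_abs]; linarith) (abs_nonneg _) |>.2
    have h2 : |(B : ℝ)| ≤ v :=
      abs_le_of_sq_le_sq' (by rw [sq_abs]; linarith) (hu0.trans huv) |>.2
    simp only [Finset.mem_union, Finset.mem_Icc, Int.ceil_le, Int.le_floor]
    rcases abs_cases (B : ℝ) with ⟨h, -⟩ | ⟨h, -⟩ <;> rw [h] at h1 h2
    · exact Or.inl ⟨h1, h2⟩
    · exact Or.inr ⟨by linarith, by linarith⟩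

/-- For `|A| ≤ t²`, the integers `B` with `|4A³ + 27B²| ≤ t⁶` lie in an interval of length
`O(t³)`. -/
theorem exists_finset_of_le_sq {t : ℝ} (ht : 1 ≤ t) :
    ∃ F : Finset ℤ, (F.card : ℝ) ≤ 3 * t ^ 3 ∧
      ∀ A B : ℤ, |(A : ℝ)| ≤ t ^ 2 → |4 * (A : ℝ) ^ 3 + 27 * (B : ℝ) ^ 2| ≤ t ^ 6 → B ∈ F := by
  have ht3 : 1 ≤ t ^ 3 := one_le_pow₀ ht
  refine ⟨Finset.Icc ⌈-t ^ 3⌉ ⌊t ^ 3⌋, ?_, fun A B hA hB => ?_⟩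
  · have := card_Icc_ceil_floor_le (show -t ^ 3 ≤ t ^ 3 by linarith)
    linarith
  · have hA3 : |(A : ℝ) ^ 3| ≤ t ^ 6 := by
      rw [abs_pow]
      calc |(A : ℝ)| ^ 3 ≤ (t ^ 2) ^ 3 := by gcongr
        _ = t ^ 6 := by ring
    have h1 := abs_le.1 hA3
    have h2 := abs_le.1 hB
    have h3 : (0 : ℝ) < t ^ 6 := by positivity
    simp only [Finset.mem_Icc, Int.ceil_le, Int.le_floor]
    exact abs_le_of_sq_le_sq' (by nlinarith) (by linarith)

/-- A telescoping majorant for `n ^ (-3/2)`. -/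
theorem inv_mul_sqrt_succ_le {x : ℝ} (hx : 0 < x) :
    1 / ((x + 1) * √(x + 1)) ≤ 2 * (1 / √x - 1 / √(x + 1)) := by
  have ha : 0 < √x := Real.sqrt_pos.2 hx
  have hb : 0 < √(x + 1) := Real.sqrt_pos.2 (by linarith)
  have hab : √x ≤ √(x + 1) := Real.sqrt_le_sqrt (by linarith)
  have ha2 : √x ^ 2 = x := Real.sq_sqrt hx.le
  have hb2 : √(x + 1) ^ 2 = x + 1 := Real.sq_sqrt (by linarith)
  generalize √x = a at *
  generalize √(x + 1) = b at *
  have hd : (b - a) * (b + a) = 1 := by linarith [show (b - a) * (b + a) = b ^ 2 - a ^ 2 by ring]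
  have hd0 : 0 ≤ b - a := by linarith
  rw [← hb2, div_sub_div _ _ ha.ne' hb.ne', mul_div_assoc', div_le_div_iff₀ (by positivity)
    (by positivity)]
  have key : a ≤ 2 * (b - a) * b ^ 2 := by
    nlinarith [mul_nonneg hd0 (mul_nonneg hb.le hd0)]
  nlinarith

/-- A sum of terms that are `O(t³)` up to `t²` and `O(1 + t⁶ n ^ (-3/2))` beyond. -/
theorem sum_range_le_of_bounds {t : ℝ} (ht : 1 ≤ t) {g : ℕ → ℝ} (hg : ∀ n, 0 ≤ g n)
    (hsmall : ∀ n : ℕ, (n : ℝ) ≤ t ^ 2 → g n ≤ 3 * t ^ 3)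
    (hlarge : ∀ n : ℕ, t ^ 2 < n → g n ≤ 2 + 2 * t ^ 6 / (n * √n)) (N : ℕ) :
    ∑ n ∈ Finset.range (N + 1), g n ≤ 14 * t ^ 5 + 2 * N := by
  have ht2 : 1 ≤ t ^ 2 := one_le_pow₀ ht
  set M := ⌊t ^ 2⌋₊ with hM
  have hM1 : 1 ≤ M := Nat.one_le_floor_iff _ |>.2 ht2
  have hMr : (1 : ℝ) ≤ M := by exact_mod_cast hM1
  have hMle : (M : ℝ) ≤ t ^ 2 := Nat.floor_le (by positivity)
  have hMlt : t ^ 2 < M + 1 := Nat.lt_floor_add_one _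
  have hbase : ∑ n ∈ Finset.range (M + 1), g n ≤ 6 * t ^ 5 := by
    calc ∑ n ∈ Finset.range (M + 1), g n ≤ ∑ n ∈ Finset.range (M + 1), 3 * t ^ 3 := by
          refine Finset.sum_le_sum fun n hn => hsmall n (le_trans ?_ hMle)
          exact_mod_cast Nat.lt_succ_iff.1 (Finset.mem_range.1 hn)
      _ = (M + 1) * (3 * t ^ 3) := by simp
      _ ≤ (2 * t ^ 2) * (3 * t ^ 3) := by gcongr; linarith
      _ = 6 * t ^ 5 := by ring
  have hind : ∀ k : ℕ, ∑ n ∈ Finset.range (M + 1 + k), g n ≤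
      6 * t ^ 5 + 2 * k + 4 * t ^ 6 * (1 / √(M : ℝ) - 1 / √((M : ℝ) + k)) := by
    intro k
    induction k with
    | zero => simpa using hbase
    | succ k ih =>
      rw [← add_assoc, Finset.sum_range_succ]
      have h1 := hlarge (M + 1 + k) (by push_cast; linarith [(Nat.cast_nonneg k : (0 : ℝ) ≤ k)])
      have h2 := inv_mul_sqrt_succ_le (x := (M : ℝ) + k) (by positivity)
      have h3 := mul_le_mul_of_nonneg_left h2 (show 0 ≤ 2 * t ^ 6 by positivity)
      rw [mul_one_div] at h3
      push_cast at h1 ⊢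
      rw [show (M : ℝ) + 1 + k = M + k + 1 by ring] at h1
      rw [← add_assoc]
      linarith
  have hsq : t / 2 ≤ √(M : ℝ) := Real.le_sqrt_of_sq_le (by nlinarith)
  have hinv : 1 / √(M : ℝ) ≤ 2 / t := by
    calc 1 / √(M : ℝ) ≤ 1 / (t / 2) := by gcongr
      _ = 2 / t := by field_simp
  calc ∑ n ∈ Finset.range (N + 1), g n ≤ ∑ n ∈ Finset.range (M + 1 + N), g n :=
        Finset.sum_le_sum_of_subset_of_nonneg (Finset.range_mono (by omega)) fun n _ _ => hg n
    _ ≤ _ := hind N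
    _ ≤ 6 * t ^ 5 + 2 * N + 4 * t ^ 6 * (2 / t) := by
        have : 0 ≤ 1 / √((M : ℝ) + N) := by positivity
        gcongr
        linarith
    _ = 14 * t ^ 5 + 2 * N := by
        field_simp
        ring

/-- The pairs `(A, B)` with `|A| ≤ N` and `|4A³ + 27B²| ≤ t⁶` number at most `28t⁵ + 4N`. -/
theorem ncard_pairs_le {t : ℝ} (ht : 1 ≤ t) (N : ℕ) :
    (({p : ℤ × ℤ | p.1.natAbs ≤ N ∧
      |4 * (p.1 : ℝ) ^ 3 + 27 * (p.2 : ℝ) ^ 2| ≤ t ^ 6}.ncard : ℕ) : ℝ) ≤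
      28 * t ^ 5 + 4 * N := by
  classical
  have hfib : ∀ n : ℕ, ∃ F : Finset ℤ, ((n : ℝ) ≤ t ^ 2 → (F.card : ℝ) ≤ 3 * t ^ 3) ∧
      (t ^ 2 < n → (F.card : ℝ) ≤ 2 + 2 * t ^ 6 / (n * √n)) ∧
      ∀ A B : ℤ, A.natAbs = n → |4 * (A : ℝ) ^ 3 + 27 * (B : ℝ) ^ 2| ≤ t ^ 6 → B ∈ F := by
    intro n
    rcases le_or_gt (n : ℝ) (t ^ 2) with hn | hn
    · obtain ⟨F, hF, hmem⟩ := exists_finset_of_le_sq ht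
      refine ⟨F, fun _ => hF, fun h => absurd h hn.not_gt, fun A B hA => hmem A B ?_⟩
      rwa [← Int.cast_abs, Int.abs_eq_natAbs, hA]
    · obtain ⟨F, hF, hmem⟩ := exists_finset_of_sq_lt ht hn
      refine ⟨F, fun h => absurd hn h.not_gt, fun _ => hF, fun A B hA hB => hmem B ?_⟩
      have hn3 : t ^ 6 < (n : ℝ) ^ 3 := by
        calc t ^ 6 = (t ^ 2) ^ 3 := by ring
          _ < _ := by gcongr
      rcases Int.natAbs_eq A with h | h <;> rw [hA] at h <;> rw [h] at hB <;> push_cast at hB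
      · have := (abs_le.1 hB).2
        nlinarith [sq_nonneg (B : ℝ), show 0 < t ^ 6 by positivity]
      · rwa [show 27 * (B : ℝ) ^ 2 - 4 * (n : ℝ) ^ 3 = 4 * (-(n : ℝ)) ^ 3 + 27 * (B : ℝ) ^ 2 by ring]
  choose F hsmall hlarge hmem using hfib
  set S : Finset (ℤ × ℤ) :=
    (Finset.range (N + 1)).biUnion fun n => ({(n : ℤ), -(n : ℤ)} : Finset ℤ) ×ˢ F n with hS
  have hcard : S.card ≤ ∑ n ∈ Finset.range (N + 1), 2 * (F n).card := by
    refine Finset.card_biUnion_le.trans (Finset.sum_le_sum fun n _ => ?_)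
    rw [Finset.card_product]
    exact Nat.mul_le_mul_right _ Finset.card_le_two
  have hsum := sum_range_le_of_bounds ht (g := fun n => ((F n).card : ℝ))
    (fun n => Nat.cast_nonneg _) hsmall hlarge N
  have hsub : {p : ℤ × ℤ | p.1.natAbs ≤ N ∧
      |4 * (p.1 : ℝ) ^ 3 + 27 * (p.2 : ℝ) ^ 2| ≤ t ^ 6} ⊆ (S : Set (ℤ × ℤ)) := by
    rintro ⟨A, B⟩ ⟨hA, hB⟩
    simp only [hS, Finset.coe_biUnion, Set.mem_iUnion, Finset.mem_coe, Finset.mem_product,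
      Finset.mem_insert, Finset.mem_singleton, Finset.mem_range]
    exact ⟨A.natAbs, Nat.lt_succ_of_le hA, Int.natAbs_eq A, hmem _ A B rfl hB⟩
  have hle := Set.ncard_le_ncard hsub S.finite_toSet
  rw [Set.ncard_coe_finset] at hle
  have hle' : (({p : ℤ × ℤ | p.1.natAbs ≤ N ∧
      |4 * (p.1 : ℝ) ^ 3 + 27 * (p.2 : ℝ) ^ 2| ≤ t ^ 6}.ncard : ℕ) : ℝ) ≤
      2 * ∑ n ∈ Finset.range (N + 1), ((F n).card : ℝ) := by
    rw [Finset.mul_sum]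
    exact_mod_cast hle.trans hcard
  linarith

/-- `#{(A,B) ∈ ℤ² : |A| ≤ X^{1/3}, |4A³ + 27B²| ≤ X^{1-δ}} ≪ X^{5/6 - 5δ/6}` for fixed
`δ ∈ (0, 1/6)`. -/
theorem pairs_small_sum_count (δ : ℝ) (hδ : δ ∈ Set.Ioo (0 : ℝ) (1 / 6)) :
    ∃ C : ℝ, 0 < C ∧ ∀ X : ℝ, 1 ≤ X →
      (Nat.card {p : ℤ × ℤ // |(p.1 : ℝ)| ≤ X ^ ((1 : ℝ) / 3) ∧
        |(4 * p.1 ^ 3 + 27 * p.2 ^ 2 : ℤ)| ≤ X ^ (1 - δ)} : ℝ) ≤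
        C * X ^ (5 / 6 - 5 * δ / 6) := by
  obtain ⟨-, hδ'⟩ := hδ
  refine ⟨32, by norm_num, fun X hX => ?_⟩
  have hX0 : 0 ≤ X := by linarith
  set t := X ^ ((1 - δ) / 6) with ht
  have ht1 : 1 ≤ t := Real.one_le_rpow hX (by linarith)
  have ht6 : X ^ (1 - δ) = t ^ 6 := by
    rw [ht, ← Real.rpow_mul_natCast hX0]
    congr 1
    push_cast
    ring
  have ht5 : X ^ (5 / 6 - 5 * δ / 6) = t ^ 5 := by
    rw [ht, ← Real.rpow_mul_natCast hX0]
    congr 1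
    push_cast
    ring
  set N := ⌊X ^ ((1 : ℝ) / 3)⌋₊ with hN
  have hNt : (N : ℝ) ≤ t ^ 5 := by
    rw [← ht5]
    exact (Nat.floor_le (by positivity)).trans
      (Real.rpow_le_rpow_of_exponent_le hX (by linarith))
  have hset : {p : ℤ × ℤ | |(p.1 : ℝ)| ≤ X ^ ((1 : ℝ) / 3) ∧
      |(4 * p.1 ^ 3 + 27 * p.2 ^ 2 : ℤ)| ≤ X ^ (1 - δ)} =
      {p : ℤ × ℤ | p.1.natAbs ≤ N ∧
        |4 * (p.1 : ℝ) ^ 3 + 27 * (p.2 : ℝ) ^ 2| ≤ t ^ 6} := by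
    ext p
    simp only [Set.mem_ofPred_eq, hN, Nat.le_floor_iff (show 0 ≤ X ^ ((1 : ℝ) / 3) by positivity),
      Nat.cast_natAbs, Int.cast_abs, ht6]
    push_cast
    rfl
  have hcount := ncard_pairs_le ht1 N
  rw [← hset, ← Nat.card_coe_set_eq] at hcount
  rw [ht5]
  calc _ ≤ 28 * t ^ 5 + 4 * (N : ℝ) := hcount
    _ ≤ 32 * t ^ 5 := by linarith
end
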